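/- Let B=(G,H) be a pseudo-Laman bigraph with biedge set ℰ, |ℰ|≥2, without self-loops, and fix a biedge ē∈ℰ. Consider all pairs (ℳ,𝒩) of subsets of ℰ satisfying ℳ∪𝒩=ℰ, ℳ∩𝒩={ē}, |ℳ|≥2, |𝒩|≥2, and such that both ^ℳB and B^𝒩 are pseudo-Laman. Assume that B has a Laman number Lam(B) with respect to ē, and that each of the bigraphs ^{{ē}}B, B^{{ē}}, and ^ℳB, B^𝒩 for every such pair (ℳ,𝒩), has a Laman number with respect to some choice of distinguished biedge (with the convention that a bigraph containing a self-loop has Laman number 0). Then Lam(B) = Lam(^{{ē}}B) + Lam(B^{{ē}}) + Σ_{(ℳ,𝒩)} Lam(^ℳB)·Lam(B^𝒩), where the sum ranges over all pairs (ℳ,𝒩) as above. -/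

import Mathlib

set_option maxHeartbeats 1000000

noncomputable section
open Classical

namespace LamanPaper

variable {V E : Type}

/-- The adjacency relation induced by an incidence map `ends`. -/
def adjRel (ends : E → Sym2 V) : V → V → Prop := fun u v => ∃ e : E, ends e = s(u, v)

/-- The setoid of connected components of the graph with incidence map `ends`. -/
def ccSetoid (ends : E → Sym2 V) : Setoid V :=
  ⟨Relation.EqvGen (adjRel ends), Relation.EqvGen.is_equivalence _⟩

/-- The number of connected components. -/
def numCC (ends : E → Sym2 V) : ℕ := Nat.card (Quotient (ccSetoid ends))

/-- The dimension of a graph: number of vertices minus number of connected components. -/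
def gDim (ends : E → Sym2 V) : ℕ := Nat.card V - numCC ends

/-- Restriction of a graph to a set of edges. -/
def restrictEnds (ends : E → Sym2 V) (S : Set E) : {e : E // e ∈ S} → Sym2 V :=
  fun e => ends e.1

/-- Deletion of a set of edges from a graph. -/
def deleteEnds (ends : E → Sym2 V) (S : Set E) : {e : E // e ∉ S} → Sym2 V :=
  fun e => ends e.1

/-- The setoid on vertices generated by contracting the edges in `S`. -/
def contrSetoid (ends : E → Sym2 V) (S : Set E) : Setoid V :=
  ⟨Relation.EqvGen fun u v => ∃ e ∈ S, ends e = s(u, v), Relation.EqvGen.is_equivalence _⟩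

/-- Contraction of the edges in `S`: the remaining edges join the equivalence classes of
their endpoints. -/
def contractEnds (ends : E → Sym2 V) (S : Set E) :
    {e : E // e ∉ S} → Sym2 (Quotient (contrSetoid ends S)) :=
  fun e => (ends e.1).map (Quotient.mk (contrSetoid ends S))

/-- An edge is a bridge if deleting it increases the number of connected components. -/
def IsBridge (ends : E → Sym2 V) (e : E) : Prop :=
  numCC ends < numCC (deleteEnds ends ({e} : Set E))

/-- The smaller endpoint of an (unordered) edge, with respect to a linear order. -/
def sMin [LinearOrder V] (s : Sym2 V) : V :=
  Sym2.lift ⟨fun a b => min a b, fun a b => min_comm a b⟩ s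

/-- The larger endpoint of an (unordered) edge, with respect to a linear order. -/
def sMax [LinearOrder V] (s : Sym2 V) : V :=
  Sym2.lift ⟨fun a b => max a b, fun a b => max_comm a b⟩ s

theorem sMin_mem [LinearOrder V] (s : Sym2 V) : sMin s ∈ s := by
  induction s using Sym2.ind with
  | _ x y => rcases min_choice x y with h | h <;> simp [sMin, Sym2.lift_mk, h, Sym2.mem_iff]

theorem sMax_mem [LinearOrder V] (s : Sym2 V) : sMax s ∈ s := by
  induction s using Sym2.ind with
  | _ x y => rcases max_choice x y with h | h <;> simp [sMax, Sym2.lift_mk, h, Sym2.mem_iff]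

/-- A bigraph: a pair of finite multigraphs `G = (V, ℰ)` and `H = (W, ℰ)` sharing the same
set of (bi)edges, together with fixed total orders on the two vertex sets. -/
structure Bigraph where
  ℰ : Type
  V : Type
  W : Type
  finE : Finite ℰ
  finV : Finite V
  finW : Finite W
  τG : ℰ → Sym2 V
  τH : ℰ → Sym2 W
  ordV : LinearOrder V
  ordW : LinearOrder W

namespace Bigraph

variable (B : Bigraph)

instance : Finite B.ℰ := B.finE
instance : Finite B.V := B.finV
instance : Finite B.W := B.finW

/-- The dimension of the first graph of a bigraph. -/
def dimG : ℕ := gDim B.τG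

/-- The dimension of the second graph of a bigraph. -/
def dimH : ℕ := gDim B.τH

/-- A bigraph is pseudo-Laman if `dim G + dim H = |ℰ| + 1`. -/
def PseudoLaman : Prop := B.dimG + B.dimH = Nat.card B.ℰ + 1

/-- A bigraph has a (self-)loop if some biedge is a self-loop in `G` or in `H`. -/
def HasLoop : Prop := (∃ e, (B.τG e).IsDiag) ∨ (∃ e, (B.τH e).IsDiag)

/-- The set `P` of ordered pairs of distinct vertices of `G` joined by some edge. -/
def Pset : Set (B.V × B.V) := {p | p.1 ≠ p.2 ∧ ∃ e, B.τG e = s(p.1, p.2)}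

/-- The set `Q` of ordered pairs of distinct vertices of `H` joined by some edge. -/
def Qset : Set (B.W × B.W) := {q | q.1 ≠ q.2 ∧ ∃ e, B.τH e = s(q.1, q.2)}

/-- The smaller endpoint (w.r.t. the fixed total order) of a biedge in `G`. -/
def eFstG (e : B.ℰ) : B.V := letI := B.ordV; sMin (B.τG e)

/-- The larger endpoint of a biedge in `G`. -/
def eSndG (e : B.ℰ) : B.V := letI := B.ordV; sMax (B.τG e)

/-- The smaller endpoint of a biedge in `H`. -/
def eFstH (e : B.ℰ) : B.W := letI := B.ordW; sMin (B.τH e)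

/-- The larger endpoint of a biedge in `H`. -/
def eSndH (e : B.ℰ) : B.W := letI := B.ordW; sMax (B.τH e)

theorem eFstG_mem (e : B.ℰ) : B.eFstG e ∈ B.τG e := by
  letI := B.ordV; exact sMin_mem _

theorem eSndG_mem (e : B.ℰ) : B.eSndG e ∈ B.τG e := by
  letI := B.ordV; exact sMax_mem _

theorem eFstH_mem (e : B.ℰ) : B.eFstH e ∈ B.τH e := by
  letI := B.ordW; exact sMin_mem _

theorem eSndH_mem (e : B.ℰ) : B.eSndH e ∈ B.τH e := by
  letI := B.ordW; exact sMax_mem _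

/-- The affine solution set `Z^B(λ)` of a bigraph with distinguished biedge `ebar` and
parameters `lam`. -/
def ZSet (ebar : B.ℰ) (lam : {e : B.ℰ // e ≠ ebar} → ℂ) :
    Set ((↥B.Pset → ℂ) × (↥B.Qset → ℂ)) :=
  {xy |
    (∀ p : ↥B.Pset, (p : B.V × B.V) = (B.eFstG ebar, B.eSndG ebar) → xy.1 p = 1) ∧
    (∀ q : ↥B.Qset, (q : B.W × B.W) = (B.eFstH ebar, B.eSndH ebar) → xy.2 q = 1) ∧
    (∀ e : {e : B.ℰ // e ≠ ebar}, ∀ p : ↥B.Pset, ∀ q : ↥B.Qset,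
      (p : B.V × B.V) = (B.eFstG e.1, B.eSndG e.1) →
      (q : B.W × B.W) = (B.eFstH e.1, B.eSndH e.1) →
      xy.1 p * xy.2 q = lam e) ∧
    (∀ (n : ℕ) (u : ℕ → B.V) (w : Fin n → ↥B.Pset),
      (∀ i : Fin n, (w i : B.V × B.V) = (u i.1, u (i.1 + 1))) → u n = u 0 →
      ∑ i, xy.1 (w i) = 0) ∧
    (∀ (n : ℕ) (u : ℕ → B.W) (w : Fin n → ↥B.Qset),
      (∀ i : Fin n, (w i : B.W × B.W) = (u i.1, u (i.1 + 1))) → u n = u 0 →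
      ∑ i, xy.2 (w i) = 0)}

/-- `B` has Laman number `N` with respect to the biedge `ebar`:  there is a nonzero
polynomial `p` in the parameters such that whenever `p` does not vanish, the solution set
`Z^B(λ)` has exactly `N` elements.  By convention a bigraph containing a self-loop has
Laman number `0`. -/
def HasLamanNumber (ebar : B.ℰ) (N : ℕ) : Prop :=
  (B.HasLoop ∧ N = 0) ∨
  (¬ B.HasLoop ∧ ∃ P : MvPolynomial {e : B.ℰ // e ≠ ebar} ℂ, P ≠ 0 ∧
    ∀ lam : {e : B.ℰ // e ≠ ebar} → ℂ, MvPolynomial.eval lam P ≠ 0 →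
      (B.ZSet ebar lam).Finite ∧ Nat.card ↥(B.ZSet ebar lam) = N)

/-- The bigraph obtained by restricting the biedges to a subset `S` (both in `G` and `H`). -/
def restrict (S : Set B.ℰ) : Bigraph where
  ℰ := {e : B.ℰ // e ∈ S}
  V := B.V
  W := B.W
  finE := Subtype.finite
  finV := B.finV
  finW := B.finW
  τG := fun e => B.τG e.1
  τH := fun e => B.τH e.1
  ordV := B.ordV
  ordW := B.ordW

/-- The bigraph `^M B = (G / M, H ∖ M)`: contract the biedges of `M` in `G` and delete them
in `H`. -/
def ctrG (M : Set B.ℰ) (ord : LinearOrder (Quotient (contrSetoid B.τG M))) : Bigraph where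
  ℰ := {e : B.ℰ // e ∉ M}
  V := Quotient (contrSetoid B.τG M)
  W := B.W
  finE := Subtype.finite
  finV := Quotient.finite _
  finW := B.finW
  τG := contractEnds B.τG M
  τH := fun e => B.τH e.1
  ordV := ord
  ordW := B.ordW

/-- The bigraph `B ^ M = (G ∖ M, H / M)`: delete the biedges of `M` in `G` and contract them
in `H`. -/
def ctrH (M : Set B.ℰ) (ord : LinearOrder (Quotient (contrSetoid B.τH M))) : Bigraph where
  ℰ := {e : B.ℰ // e ∉ M}
  V := B.V
  W := Quotient (contrSetoid B.τH M)
  finE := Subtype.finite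
  finV := B.finV
  finW := Quotient.finite _
  τG := fun e => B.τG e.1
  τH := contractEnds B.τH M
  ordV := B.ordV
  ordW := ord

/-! ### Bidistances -/

/-- Symmetry of a function on `P`: `d_V(u,v) = d_V(v,u)`. -/
def BidistSymmG (dV : ↥B.Pset → ℚ) : Prop :=
  ∀ p p' : ↥B.Pset, (p' : B.V × B.V) = ((p : B.V × B.V).2, (p : B.V × B.V).1) → dV p' = dV p

/-- Symmetry of a function on `Q`: `d_W(t,w) = d_W(w,t)`. -/
def BidistSymmH (dW : ↥B.Qset → ℚ) : Prop :=
  ∀ q q' : ↥B.Qset, (q' : B.W × B.W) = ((q : B.W × B.W).2, (q : B.W × B.W).1) → dW q' = dW q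

/-- The sum condition: `d_V(u,v) + d_W(t,w) = wt(e)` for every biedge `e ≠ ebar`. -/
def BidistSum (ebar : B.ℰ) (wt : {e : B.ℰ // e ≠ ebar} → ℚ)
    (dV : ↥B.Pset → ℚ) (dW : ↥B.Qset → ℚ) : Prop :=
  ∀ e : {e : B.ℰ // e ≠ ebar}, ∀ p : ↥B.Pset, ∀ q : ↥B.Qset,
    s((p : B.V × B.V).1, (p : B.V × B.V).2) = B.τG e.1 →
    s((q : B.W × B.W).1, (q : B.W × B.W).2) = B.τH e.1 →
    dV p + dW q = wt e

/-- The base condition: `d_V(ū,v̄) = d_W(t̄,w̄) = 0` on the distinguished biedge. -/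
def BidistBase (ebar : B.ℰ) (dV : ↥B.Pset → ℚ) (dW : ↥B.Qset → ℚ) : Prop :=
  (∀ p : ↥B.Pset, s((p : B.V × B.V).1, (p : B.V × B.V).2) = B.τG ebar → dV p = 0) ∧
  (∀ q : ↥B.Qset, s((q : B.W × B.W).1, (q : B.W × B.W).2) = B.τH ebar → dW q = 0)

/-- On every closed walk in `G`, the minimum of `d_V` over the consecutive vertex pairs is
attained at least twice. -/
def BidistMinG (dV : ↥B.Pset → ℚ) : Prop :=
  ∀ (n : ℕ) (u : ℕ → B.V) (w : Fin n → ↥B.Pset),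
    (∀ i : Fin n, (w i : B.V × B.V) = (u i.1, u (i.1 + 1))) → u n = u 0 →
    ∀ i : Fin n, (∀ k, dV (w i) ≤ dV (w k)) → ∃ j, j ≠ i ∧ dV (w j) = dV (w i)

/-- On every closed walk in `H`, the minimum of `d_W` over the consecutive vertex pairs is
attained at least twice. -/
def BidistMinH (dW : ↥B.Qset → ℚ) : Prop :=
  ∀ (n : ℕ) (u : ℕ → B.W) (w : Fin n → ↥B.Qset),
    (∀ i : Fin n, (w i : B.W × B.W) = (u i.1, u (i.1 + 1))) → u n = u 0 →
    ∀ i : Fin n, (∀ k, dW (w i) ≤ dW (w k)) → ∃ j, j ≠ i ∧ dW (w j) = dW (w i)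

/-- A bidistance on `B` compatible with the weight vector `wt`. -/
def IsBidistance (ebar : B.ℰ) (wt : {e : B.ℰ // e ≠ ebar} → ℚ)
    (dV : ↥B.Pset → ℚ) (dW : ↥B.Qset → ℚ) : Prop :=
  B.BidistSymmG dV ∧ B.BidistSymmH dW ∧ B.BidistSum ebar wt dV dW ∧
  B.BidistBase ebar dV dW ∧ B.BidistMinG dV ∧ B.BidistMinH dW

/-! ### The quotient bigraph `B_d` -/

/-- The value of `d_V` on (the endpoint pair of) a biedge. -/
def gvalG (dV : ↥B.Pset → ℚ) (e : B.ℰ) : ℚ :=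
  if h : ∃ p : ↥B.Pset, s((p : B.V × B.V).1, (p : B.V × B.V).2) = B.τG e then dV h.choose
  else 0

/-- The value of `d_W` on (the endpoint pair of) a biedge. -/
def gvalH (dW : ↥B.Qset → ℚ) (e : B.ℰ) : ℚ :=
  if h : ∃ q : ↥B.Qset, s((q : B.W × B.W).1, (q : B.W × B.W).2) = B.τH e then dW h.choose
  else 0

/-- Incidences of the graph `G`: pairs of a biedge and one of its endpoints. -/
def IncG := {q : B.ℰ × B.V // q.2 ∈ B.τG q.1}

/-- Incidences of the graph `H`. -/
def IncH := {q : B.ℰ × B.W // q.2 ∈ B.τH q.1}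

instance : Finite B.IncG := by unfold IncG; infer_instance
instance : Finite B.IncH := by unfold IncH; infer_instance

/-- Two incidences `(e,v)`, `(e',v')` of `G` are identified in `B_d` if the `d_V`-levels of
`e` and `e'` agree (say equal to `α`) and `v`, `v'` are connected by edges of level `> α`. -/
def relIncG (dV : ↥B.Pset → ℚ) : B.IncG → B.IncG → Prop := fun a b =>
  B.gvalG dV a.1.1 = B.gvalG dV b.1.1 ∧
  Relation.EqvGen (fun u v => ∃ e, B.gvalG dV a.1.1 < B.gvalG dV e ∧ B.τG e = s(u, v))
    a.1.2 b.1.2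

def relIncH (dW : ↥B.Qset → ℚ) : B.IncH → B.IncH → Prop := fun a b =>
  B.gvalH dW a.1.1 = B.gvalH dW b.1.1 ∧
  Relation.EqvGen (fun u v => ∃ e, B.gvalH dW a.1.1 < B.gvalH dW e ∧ B.τH e = s(u, v))
    a.1.2 b.1.2

def incSetoidG (dV : ↥B.Pset → ℚ) : Setoid B.IncG :=
  ⟨Relation.EqvGen (B.relIncG dV), Relation.EqvGen.is_equivalence _⟩

def incSetoidH (dW : ↥B.Qset → ℚ) : Setoid B.IncH :=
  ⟨Relation.EqvGen (B.relIncH dW), Relation.EqvGen.is_equivalence _⟩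

/-- The vertices of the first graph `G_{d_V}` of the quotient bigraph `B_d`:
classes of incidences.  This realizes the disjoint union of the contractions
`G_{≥α} / G_{>α}` (with isolated vertices discarded). -/
def QVertG (dV : ↥B.Pset → ℚ) := Quotient (B.incSetoidG dV)

def QVertH (dW : ↥B.Qset → ℚ) := Quotient (B.incSetoidH dW)

/-- The incidence map of `G_{d_V}`. -/
def quotEndsG (dV : ↥B.Pset → ℚ) : B.ℰ → Sym2 (B.QVertG dV) := fun e =>
  s(Quotient.mk (B.incSetoidG dV) ⟨(e, B.eFstG e), B.eFstG_mem e⟩,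
    Quotient.mk (B.incSetoidG dV) ⟨(e, B.eSndG e), B.eSndG_mem e⟩)

/-- The incidence map of `H_{d_W}`. -/
def quotEndsH (dW : ↥B.Qset → ℚ) : B.ℰ → Sym2 (B.QVertH dW) := fun e =>
  s(Quotient.mk (B.incSetoidH dW) ⟨(e, B.eFstH e), B.eFstH_mem e⟩,
    Quotient.mk (B.incSetoidH dW) ⟨(e, B.eSndH e), B.eSndH_mem e⟩)

/-- The quotient bigraph `B_d = (G_{d_V}, H_{d_W})` of a bigraph by a bidistance `(d_V, d_W)`,
with arbitrarily fixed total orders on the new vertex sets.  It has the same biedges as `B`. -/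
def quotBigraph (dV : ↥B.Pset → ℚ) (dW : ↥B.Qset → ℚ)
    (oV : LinearOrder (B.QVertG dV)) (oW : LinearOrder (B.QVertH dW)) : Bigraph where
  ℰ := B.ℰ
  V := B.QVertG dV
  W := B.QVertH dW
  finE := B.finE
  finV := Quotient.finite _
  finW := Quotient.finite _
  τG := B.quotEndsG dV
  τH := B.quotEndsH dW
  ordV := oV
  ordW := oW

/-! ### Untangling -/

/-- `B` untangles via the biedge `ebar` with respect to the decomposition
`ℰ = E1 ⊔ E2 ⊔ {ebar}`, `V = V1 ⊔ V2`, `W = W1 ⊔ W2`:  the graph `G` is the disjoint union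
of the subgraph on `V1` with edges `E1 ∪ {ebar}` and the subgraph on `V2` with edges `E2`,
while `H` is the disjoint union of the subgraph on `W1` with edges `E1` and the subgraph on
`W2` with edges `E2 ∪ {ebar}`.  The two bigraphs into which `B` untangles are then
`B₁ = B.restrict E1` and `B₂ = B.restrict E2`. -/
def Untangles (ebar : B.ℰ) (E1 E2 : Set B.ℰ) (V1 V2 : Set B.V) (W1 W2 : Set B.W) : Prop :=
  ebar ∉ E1 ∧ ebar ∉ E2 ∧ E1 ∩ E2 = ∅ ∧ (∀ e : B.ℰ, e = ebar ∨ e ∈ E1 ∨ e ∈ E2) ∧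
  V1 ∩ V2 = ∅ ∧ V1 ∪ V2 = Set.univ ∧
  (∀ e ∈ E1, ∀ v, v ∈ B.τG e → v ∈ V1) ∧ (∀ v, v ∈ B.τG ebar → v ∈ V1) ∧
  (∀ e ∈ E2, ∀ v, v ∈ B.τG e → v ∈ V2) ∧
  W1 ∩ W2 = ∅ ∧ W1 ∪ W2 = Set.univ ∧
  (∀ e ∈ E1, ∀ x, x ∈ B.τH e → x ∈ W1) ∧
  (∀ e ∈ E2, ∀ x, x ∈ B.τH e → x ∈ W2) ∧ (∀ x, x ∈ B.τH ebar → x ∈ W2)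

/-! ### The rational map `f_B` -/

/-- The vector of coordinates of the rational map `f_B`, evaluated on representatives
`x : V → ℂ` and `y : W → ℂ`:  the `e`-th coordinate is `(x_u - x_v)(y_t - y_w)` where
`{u,v} = τ_G(e)` with `u ≺ v` and `{t,w} = τ_H(e)` with `t ≺ w`.  (For a self-loop the
corresponding factor is `0`.) -/
def fVec (x : B.V → ℂ) (y : B.W → ℂ) : B.ℰ → ℂ :=
  fun e => (x (B.eFstG e) - x (B.eSndG e)) * (y (B.eFstH e) - y (B.eSndH e))

/-- The subspace `L_G` of vectors that are constant on each connected component of `G`. -/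
def LG : Submodule ℂ (B.V → ℂ) where
  carrier := {x | ∀ u v : B.V, Relation.EqvGen (adjRel B.τG) u v → x u = x v}
  add_mem' := by
    intro a b ha hb u v h
    simp only [Pi.add_apply, ha u v h, hb u v h]
  zero_mem' := by intro u v _; rfl
  smul_mem' := by
    intro c a ha u v h
    simp only [Pi.smul_apply, ha u v h]

/-- The subspace `L_H` of vectors that are constant on each connected component of `H`. -/
def LH : Submodule ℂ (B.W → ℂ) where
  carrier := {y | ∀ u v : B.W, Relation.EqvGen (adjRel B.τH) u v → y u = y v}
  add_mem' := by
    intro a b ha hb u v h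
    simp only [Pi.add_apply, ha u v h, hb u v h]
  zero_mem' := by intro u v _; rfl
  smul_mem' := by
    intro c a ha u v h
    simp only [Pi.smul_apply, ha u v h]

/-- Dominance of the rational map `f_B`:  the image of `f_B` is not contained in any
proper algebraic subset of `ℙ(ℂ^ℰ)`, equivalently in no zero set of a nonzero homogeneous
polynomial. -/
def FDominant : Prop :=
  ¬ ∃ (n : ℕ) (P : MvPolynomial B.ℰ ℂ), P ≠ 0 ∧ P.IsHomogeneous n ∧
      ∀ (x : B.V → ℂ) (y : B.W → ℂ), MvPolynomial.eval (B.fVec x y) P = 0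

end Bigraph


/-- The condition on a pair `(ℳ, 𝒩)` of subsets of the biedges appearing in the
recursive formula: `ℳ ∪ 𝒩 = ℰ`, `ℳ ∩ 𝒩 = {ē}`, `|ℳ| ≥ 2`, `|𝒩| ≥ 2`, and both
`^ℳB` and `B^𝒩` are pseudo-Laman. -/
def GoodPair (B : Bigraph) (ebar : B.ℰ) (MN : Set B.ℰ × Set B.ℰ) : Prop :=
  MN.1 ∪ MN.2 = Set.univ ∧ MN.1 ∩ MN.2 = {ebar} ∧
  2 ≤ MN.1.ncard ∧ 2 ≤ MN.2.ncard ∧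
  (∀ o, (B.ctrG MN.1 o).PseudoLaman) ∧ (∀ o, (B.ctrH MN.2 o).PseudoLaman)

open MeasureTheory Filter Topology


theorem ae_comp_surj {ι κ : Type} [Fintype ι] [Fintype κ] (L : (ι → ℂ) →ₗ[ℂ] (κ → ℂ))
    (hL : Function.Surjective L) {p : (κ → ℂ) → Prop} (h : ∀ᵐ y : κ → ℂ, p y) :
    ∀ᵐ x : ι → ℂ, p (L x) := by
  obtain ⟨t, ht, hsub⟩ : ∃ t : Set (κ → ℂ), MeasurableSet t ∧ t ⊆ {y | p y} ∧ volume tᶜ = 0 := by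
    have h' : volume {y | p y}ᶜ = 0 := h
    refine ⟨(toMeasurable volume {y | p y}ᶜ)ᶜ, (measurableSet_toMeasurable _ _).compl, ?_, ?_⟩
    · rw [Set.compl_subset_comm]; exact subset_toMeasurable _ _
    · rw [compl_compl, measure_toMeasurable]; exact h'
  have := (ae_comp_linearMap_mem_iff (L.restrictScalars ℝ) (volume : Measure (ι → ℂ))
    (volume : Measure (κ → ℂ)) hL ht).2 (by rw [ae_iff]; exact hsub.2)
  filter_upwards [this] with x hx using hsub.1 hx

theorem ae_poly {ι : Type} [Fintype ι] (P : MvPolynomial ι ℂ) (hP : P ≠ 0) :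
    ∀ᵐ x : ι → ℂ, MvPolynomial.eval x P ≠ 0 := by
  obtain ⟨a, ha⟩ : ∃ a, MvPolynomial.eval a P ≠ 0 := by
    by_contra! h
    exact hP (MvPolynomial.funext (fun x => by simpa using h x))
  have hcont : Continuous fun x : ι → ℂ => MvPolynomial.eval x P := MvPolynomial.continuous_eval P
  have hmeas : MeasurableSet {z : (ι → ℂ) × ℂ | MvPolynomial.eval (a + z.2 • (z.1 - a)) P ≠ 0} := by
    apply IsOpen.measurableSet
    exact isOpen_ne_fun (hcont.comp (by fun_prop)) continuous_const
  have h1 : ∀ᵐ y : ι → ℂ, ∀ᵐ t : ℂ, MvPolynomial.eval (a + t • (y - a)) P ≠ 0 := by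
    refine Filter.Eventually.of_forall fun y => ?_
    let q : Polynomial ℂ := MvPolynomial.aeval
      (fun i => Polynomial.C (a i) + Polynomial.X * Polynomial.C (y i - a i)) P
    have hq : ∀ t, q.eval t = MvPolynomial.eval (a + t • (y - a)) P := by
      intro t
      have : (Polynomial.evalRingHom t).comp (MvPolynomial.aeval
        (fun i => Polynomial.C (a i) + Polynomial.X * Polynomial.C (y i - a i)) :
        MvPolynomial ι ℂ →ₐ[ℂ] Polynomial ℂ).toRingHom = MvPolynomial.eval (a + t • (y - a)) := by
        apply MvPolynomial.ringHom_ext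
        · intro r; simp
        · intro i; simp
      exact congrArg (fun f : MvPolynomial ι ℂ →+* ℂ => f P) this
    have hq0 : q ≠ 0 := by
      intro h0
      have := hq 0
      rw [h0] at this
      simp at this
      exact ha this.symm
    rw [ae_iff]
    refine Set.Finite.measure_zero ?_ _
    refine (Polynomial.finite_setOfPred_isRoot hq0).subset ?_
    intro t ht
    simp only [ne_eq, not_not, Set.mem_ofPred_eq] at ht
    simp [Polynomial.IsRoot, hq, ht]
  rw [Measure.ae_ae_comm hmeas] at h1
  have h2 : ∀ᵐ t : ℂ, t ≠ 0 := by
    rw [ae_iff]; simp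
  obtain ⟨t, ht, ht0⟩ := (h1.and h2).exists
  -- translate / scale back
  have hsurj : Function.Surjective (t⁻¹ • LinearMap.id : (ι → ℂ) →ₗ[ℂ] (ι → ℂ)) := by
    intro y; exact ⟨t • y, by simp [ht0]⟩
  have h3 := ae_comp_surj (p := fun x => MvPolynomial.eval (a + t • (x - a)) P ≠ 0)
      (t⁻¹ • LinearMap.id : (ι → ℂ) →ₗ[ℂ] (ι → ℂ)) hsurj ht
  have h4 : Tendsto (fun x : ι → ℂ => x + (t • a - a)) (ae volume) (ae volume) :=
    (measurePreserving_add_right volume (t • a - a)).quasiMeasurePreserving.tendsto_ae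
  filter_upwards [h4.eventually h3] with x hx
  convert hx using 3
  simp [smul_sub, smul_smul, ht0, smul_add]
  abel

theorem sard_core {ι : Type} [Fintype ι] {V : Type} [NormedAddCommGroup V] [NormedSpace ℂ V]
    [FiniteDimensional ℂ V] (hdim : Module.finrank ℂ V ≤ Fintype.card ι)
    (f : V → (ι → ℂ)) (f' : V → V →L[ℂ] (ι → ℂ)) (hf : ∀ v, HasFDerivAt f (f' v) v) :
    ∀ᵐ μ : ι → ℂ, ∀ v, f v = μ → Function.Injective (f' v) := by
  obtain ⟨π, hπ⟩ : ∃ π : (ι → ℂ) →ₗ[ℂ] V, Function.Surjective π := by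
    let b := Module.finBasis ℂ V
    obtain ⟨j⟩ : Nonempty (Fin (Module.finrank ℂ V) ↪ ι) :=
      Function.Embedding.nonempty_of_card_le (by simpa using hdim)
    refine ⟨b.equivFun.symm.toLinearMap ∘ₗ LinearMap.funLeft ℂ ℂ j, ?_⟩
    exact b.equivFun.symm.surjective.comp (LinearMap.funLeft_surjective_of_injective _ _ j j.injective)
  let πc : (ι → ℂ) →L[ℂ] V := LinearMap.toContinuousLinearMap π
  have hg : ∀ w, HasFDerivAt (𝕜 := ℝ) (fun w => f (πc w))
      (((f' (πc w)).comp πc).restrictScalars ℝ) w := by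
    intro w
    exact ((hf (πc w)).comp w πc.hasFDerivAt).restrictScalars ℝ
  let s : Set (ι → ℂ) := {w | (((f' (πc w)).comp πc).restrictScalars ℝ).det = 0}
  have h0 : volume ((fun w => f (πc w)) '' s) = 0 :=
    addHaar_image_eq_zero_of_det_fderivWithin_eq_zero volume
      (fun x _ => (hg x).hasFDerivWithinAt) (fun x hx => hx)
  have : ∀ᵐ μ : ι → ℂ, μ ∉ (fun w => f (πc w)) '' s := by
    rw [ae_iff]; simp only [not_not]; exact h0
  filter_upwards [this] with μ hμ v hv
  obtain ⟨w, rfl⟩ := hπ v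
  have hw : w ∉ s := fun h => hμ ⟨w, h, hv⟩
  have hw' : LinearMap.det ((((f' (πc w)).comp πc).restrictScalars ℝ : (ι → ℂ) →L[ℝ] (ι → ℂ)) :
    (ι → ℂ) →ₗ[ℝ] (ι → ℂ)) ≠ 0 := hw
  have hinj := (LinearMap.equivOfDetNeZero _ hw').injective
  rw [injective_iff_map_eq_zero]
  intro z hz
  obtain ⟨z', rfl⟩ := hπ z
  have : z' = 0 := by
    apply hinj
    rw [map_zero]
    exact hz
  simp [this]



/-- Initial degeneration of a subspace with respect to a level function. -/
def InD {E : Type} (L : Submodule ℂ (E → ℂ)) (l : E → ℕ) : Submodule ℂ (E → ℂ) where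
  carrier := {x | ∀ k, ∃ w ∈ L, (∀ e, l e < k → w e = 0) ∧ (∀ e, l e = k → w e = x e)}
  add_mem' := by
    intro a b ha hb k
    obtain ⟨w, hw, h1, h2⟩ := ha k
    obtain ⟨w', hw', h1', h2'⟩ := hb k
    exact ⟨w + w', L.add_mem hw hw', fun e he => by simp [h1 e he, h1' e he],
      fun e he => by simp [h2 e he, h2' e he]⟩
  zero_mem' := fun k => ⟨0, L.zero_mem, fun _ _ => rfl, fun _ _ => rfl⟩
  smul_mem' := by
    intro c a ha k
    obtain ⟨w, hw, h1, h2⟩ := ha k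
    exact ⟨c • w, L.smul_mem c hw, fun e he => by simp [h1 e he],
      fun e he => by simp [h2 e he]⟩

theorem mem_InD {E : Type} {L : Submodule ℂ (E → ℂ)} {l : E → ℕ} {x : E → ℂ} :
    x ∈ InD L l ↔ ∀ k, ∃ w ∈ L, (∀ e, l e < k → w e = 0) ∧ (∀ e, l e = k → w e = x e) := Iff.rfl

/-- Solutions of the bilinear system. -/
def Zl {E : Type} (L L' : Submodule ℂ (E → ℂ)) (b : E) (lam : {e : E // e ≠ b} → ℂ) :
    Set ((E → ℂ) × (E → ℂ)) :=
  {p | p.1 ∈ L ∧ p.2 ∈ L' ∧ p.1 b = 1 ∧ p.2 b = 1 ∧ ∀ e : {e : E // e ≠ b}, p.1 e * p.2 e = lam e}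

def InjAt {E : Type} (L L' : Submodule ℂ (E → ℂ)) (b : E) (mu : {e : E // e ≠ b} → ℂ) : Prop :=
  ∀ p ∈ Zl L L' b mu, ∀ u ∈ L, ∀ v ∈ L', u b = 0 → v b = 0 →
    (∀ e : {e : E // e ≠ b}, u e * p.2 e + p.1 e * v e = 0) → u = 0 ∧ v = 0

/-- coordinate projection to a set. -/
def prj {E : Type} (S : Set E) : (E → ℂ) →ₗ[ℂ] (E → ℂ) where
  toFun x e := if e ∈ S then x e else 0
  map_add' x y := by ext e; by_cases h : e ∈ S <;> simp [h]
  map_smul' c x := by ext e; by_cases h : e ∈ S <;> simp [h]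

theorem prj_apply {E : Type} (S : Set E) (x : E → ℂ) (e : E) :
    prj S x e = if e ∈ S then x e else 0 := rfl

/-- subspace of vectors vanishing at levels below `k`. -/
def Fil {E : Type} (L : Submodule ℂ (E → ℂ)) (l : E → ℕ) (k : ℕ) : Submodule ℂ (E → ℂ) :=
  L ⊓ LinearMap.ker (prj {e | l e < k})

theorem mem_Fil {E : Type} {L : Submodule ℂ (E → ℂ)} {l : E → ℕ} {k : ℕ} {x : E → ℂ} :
    x ∈ Fil L l k ↔ x ∈ L ∧ ∀ e, l e < k → x e = 0 := by
  simp only [Fil, Submodule.mem_inf, LinearMap.mem_ker]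
  refine and_congr_right fun _ => ⟨fun h e he => ?_, fun h => ?_⟩
  · have := congrFun h e
    simpa [prj_apply, he] using this
  · ext e
    by_cases he : l e < k <;> simp [prj_apply, he, h]

theorem finrank_Fil_succ {E : Type} [Fintype E] (L : Submodule ℂ (E → ℂ)) (l : E → ℕ) (k : ℕ) :
    Module.finrank ℂ (Fil L l k) = Module.finrank ℂ ((Fil L l k).map (prj {e | l e = k}))
      + Module.finrank ℂ (Fil L l (k+1)) := by
  let f := (prj {e | l e = k}).domRestrict (Fil L l k)
  have h := LinearMap.finrank_range_add_finrank_ker f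
  have h1 : LinearMap.range f = (Fil L l k).map (prj {e | l e = k}) := by
    ext x; simp [f, Submodule.mem_map]
  have h2 : (LinearMap.ker f).map (Fil L l k).subtype = Fil L l (k+1) := by
    ext x
    simp only [Submodule.mem_map, LinearMap.mem_ker, Submodule.subtype_apply, Subtype.exists,
      mem_Fil, f, LinearMap.domRestrict_apply]
    constructor
    · rintro ⟨y, ⟨hy, hy0⟩, h0, rfl⟩
      refine ⟨hy, fun e he => ?_⟩
      rcases Nat.lt_succ_iff_lt_or_eq.1 he with h | h
      · exact hy0 e h
      · simpa [prj_apply, h] using congrFun h0 e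
    · rintro ⟨hx, h0⟩
      refine ⟨x, ⟨hx, fun e he => h0 e (by omega)⟩, ?_, rfl⟩
      ext e
      by_cases he : l e = k
      · simp [prj_apply, he, h0 e (by omega)]
      · simp [prj_apply, he]
  rw [← h, h1, ← h2, Submodule.finrank_map_subtype_eq]

theorem finrank_InD_le {E : Type} [Fintype E] (L : Submodule ℂ (E → ℂ)) (l : E → ℕ) :
    Module.finrank ℂ (InD L l) ≤ Module.finrank ℂ L := by
  obtain ⟨K, hK⟩ : ∃ K, ∀ e, l e < K :=
    ⟨(∑ e, l e) + 1, fun e => Nat.lt_succ_of_le (Finset.single_le_sum (fun _ _ => Nat.zero_le _) (Finset.mem_univ e))⟩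
  have key : ∀ j k, k + j = K → Module.finrank ℂ
      ((InD L l).map (prj {e | k ≤ l e})) ≤ Module.finrank ℂ (Fil L l k) := by
    intro j
    induction j with
    | zero =>
      intro k hk
      have : (prj {e | k ≤ l e}) = 0 := by
        ext x e
        have := hK e
        simp [prj_apply]
        intro h; omega
      rw [this, Submodule.map_zero]; simp
    | succ j ih =>
      intro k hk
      rw [finrank_Fil_succ]
      have hle : (InD L l).map (prj {e | k ≤ l e}) ≤
          ((Fil L l k).map (prj {e | l e = k})) ⊔ ((InD L l).map (prj {e | k + 1 ≤ l e})) := by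
        rintro _ ⟨x, hx, rfl⟩
        obtain ⟨w, hw, h1, h2⟩ := hx k
        refine Submodule.mem_sup.2 ⟨prj {e | l e = k} w, ⟨w, mem_Fil.2 ⟨hw, h1⟩, rfl⟩,
          prj {e | k + 1 ≤ l e} x, ⟨x, hx, rfl⟩, ?_⟩
        ext e
        rcases lt_trichotomy (l e) k with h | h | h
        · simp [prj_apply, h.ne, h.not_ge]; intro; omega
        · simp [prj_apply, h, h2 e h]
        · simp [prj_apply, h.ne', h.le]; intro; omega
      calc _ ≤ _ := Submodule.finrank_mono hle
        _ ≤ _ := Submodule.finrank_add_le_finrank_add_finrank _ _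
        _ ≤ _ := by gcongr; exact ih (k+1) (by omega)
  have h0 := key K 0 (by simp)
  have e1 : (prj {e | 0 ≤ l e}) = LinearMap.id := by ext x e; simp [prj_apply]
  rw [e1, Submodule.map_id] at h0
  exact h0.trans (Submodule.finrank_mono (fun x hx => (mem_Fil.1 hx).1))

theorem bilin_sard {ι : Type} [Fintype ι] {V : Type} [NormedAddCommGroup V] [NormedSpace ℂ V]
    [FiniteDimensional ℂ V] (hdim : Module.finrank ℂ V ≤ Fintype.card ι)
    (pX pY : ι → V →ₗ[ℂ] ℂ) (x0 y0 : ι → ℂ) :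
    ∀ᵐ mu : ι → ℂ, ∀ v, (∀ i, (x0 i + pX i v) * (y0 i + pY i v) = mu i) →
      ∀ s, (∀ i, pX i s * (y0 i + pY i v) + (x0 i + pX i v) * pY i s = 0) → s = 0 := by
  let qX : ι → (V →L[ℂ] ℂ) := fun i => LinearMap.toContinuousLinearMap (pX i)
  let qY : ι → (V →L[ℂ] ℂ) := fun i => LinearMap.toContinuousLinearMap (pY i)
  have hqX : ∀ e t, qX e t = pX e t := fun _ _ => rfl
  have hqY : ∀ e t, qY e t = pY e t := fun _ _ => rfl
  let f : V → (ι → ℂ) := fun t e => (x0 e + qX e t) * (y0 e + qY e t)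
  let f' : V → V →L[ℂ] (ι → ℂ) := fun t =>
    ContinuousLinearMap.pi fun e => (x0 e + qX e t) • qY e + (y0 e + qY e t) • qX e
  have hf : ∀ v, HasFDerivAt f (f' v) v := by
    intro v
    rw [hasFDerivAt_pi']
    intro e
    exact (((qX e).hasFDerivAt (x := v)).const_add (x0 e)).mul
      (((qY e).hasFDerivAt (x := v)).const_add (y0 e))
  filter_upwards [sard_core hdim f f' hf] with mu hmu v hv s hs
  apply hmu v (by ext e; exact hv e)
  rw [map_zero]
  ext e
  simp only [f', ContinuousLinearMap.coe_pi', add_apply, smul_apply, hqX, hqY, smul_eq_mul,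
    Pi.zero_apply]
  linear_combination hs e

/-- Generic injectivity of the differential. -/
theorem ae_InjAt {E : Type} [Fintype E] (L L' : Submodule ℂ (E → ℂ)) (b : E)
    (hdim : Module.finrank ℂ L + Module.finrank ℂ L' ≤ Fintype.card E + 1) :
    ∀ᵐ mu : {e : E // e ≠ b} → ℂ, InjAt L L' b mu := by
  by_cases hbase : (∃ x ∈ L, x b = 1) ∧ (∃ y ∈ L', y b = 1)
  swap
  · refine Eventually.of_forall fun mu p hp => ?_
    exact absurd ⟨⟨p.1, hp.1, hp.2.2.1⟩, ⟨p.2, hp.2.1, hp.2.2.2.1⟩⟩ hbase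
  obtain ⟨⟨x0, hx0, hx1⟩, ⟨y0, hy0, hy1⟩⟩ := hbase
  let Lam : (L × L') →ₗ[ℂ] ℂ × ℂ :=
    LinearMap.prodMap ((LinearMap.proj b).comp L.subtype) ((LinearMap.proj b).comp L'.subtype)
  have hLam : ∀ q, Lam q = (q.1.1 b, q.2.1 b) := fun q => rfl
  have hsurj : Function.Surjective Lam := by
    rintro ⟨c, d⟩
    refine ⟨(c • ⟨x0, hx0⟩, d • ⟨y0, hy0⟩), ?_⟩
    simp [hLam, hx1, hy1]
  let T := LinearMap.ker Lam
  have hT : Module.finrank ℂ T ≤ Fintype.card {e : E // e ≠ b} := by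
    have h := LinearMap.finrank_range_add_finrank_ker Lam
    rw [LinearMap.range_eq_top.2 hsurj] at h
    simp only [finrank_top, Module.finrank_prod, Module.finrank_self] at h
    have : Fintype.card {e : E // e ≠ b} + 1 = Fintype.card E := by
      rw [Fintype.card_subtype_compl]
      simp
      have : 0 < Fintype.card E := Fintype.card_pos_iff.2 ⟨b⟩
      omega
    change 1 + 1 + Module.finrank ℂ T = _ at h
    omega
  have hs := bilin_sard (V := T) hT
    (fun e => ((LinearMap.proj e.1).comp (L.subtype.comp ((LinearMap.fst ℂ L L').comp T.subtype))))
    (fun e => ((LinearMap.proj e.1).comp (L'.subtype.comp ((LinearMap.snd ℂ L L').comp T.subtype))))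
    (fun e => x0 e.1) (fun e => y0 e.1)
  filter_upwards [hs] with mu hmu p hp u hu v hv hub hvb h
  obtain ⟨h1, h2, h3, h4, h5⟩ := hp
  have h6 := hmu ⟨(⟨p.1 - x0, L.sub_mem h1 hx0⟩, ⟨p.2 - y0, L'.sub_mem h2 hy0⟩), by
    simp [T, LinearMap.mem_ker, hLam, h3, h4, hx1, hy1]⟩ (fun e => by simpa using h5 e)
    ⟨(⟨u, hu⟩, ⟨v, hv⟩), by simp [T, LinearMap.mem_ker, hLam, hub, hvb]⟩
    (fun e => by simpa using h e)
  simpa using h6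

/-- If the dimensions are too small, then generically there is no solution. -/
theorem ae_no_sol {A : Type} [Fintype A] [Nonempty A] (K R : Submodule ℂ (A → ℂ))
    (hdim : Module.finrank ℂ K + Module.finrank ℂ R ≤ Fintype.card A) :
    ∀ᵐ mu : A → ℂ, ∀ a ∈ K, ∀ c ∈ R, ¬ (∀ e, a e * c e = mu e) := by
  have hs := bilin_sard (V := K × R) (by simpa using hdim)
    (fun e => ((LinearMap.proj e).comp (K.subtype.comp (LinearMap.fst ℂ K R))))
    (fun e => ((LinearMap.proj e).comp (R.subtype.comp (LinearMap.snd ℂ K R))))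
    (fun _ => 0) (fun _ => 0)
  have hne : ∀ᵐ mu : A → ℂ, ∀ e, mu e ≠ 0 := by
    rw [ae_all_iff]; intro e
    have := ae_poly (MvPolynomial.X e : MvPolynomial A ℂ) (MvPolynomial.X_ne_zero e)
    simpa using this
  filter_upwards [hs, hne] with mu hmu h0 a ha c hc h
  have hs := hmu (⟨a, ha⟩, ⟨c, hc⟩) (fun e => by simpa using h e) (⟨a, ha⟩, -⟨c, hc⟩)
    (fun e => by simp)
  obtain ⟨e⟩ := ‹Nonempty A›
  have ha0 : a = 0 := by simpa using congrArg (fun z : K × R => z.1.1) hs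
  apply h0 e
  rw [← h e, ha0]; simp



theorem exists_retr {E : Type} [Fintype E] (L : Submodule ℂ (E → ℂ)) (S : Set E) :
    ∃ σ : (E → ℂ) →ₗ[ℂ] (E → ℂ), (∀ x, σ x ∈ L) ∧
      (∀ x, (∃ w ∈ L, ∀ e ∈ S, w e = x e) → ∀ e ∈ S, σ x e = x e) ∧
      (∀ x, σ (prj S x) = σ x) := by
  let f := (prj S).domRestrict L
  obtain ⟨g0, hg0⟩ := LinearMap.exists_rightInverse_of_surjective f.rangeRestrict
    (LinearMap.range_rangeRestrict f)
  obtain ⟨g, hg⟩ := LinearMap.exists_extend g0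
  have hpp : ∀ x, prj S (prj S x) = prj S x := by
    intro x; ext e; by_cases h : e ∈ S <;> simp [prj_apply, h]
  refine ⟨L.subtype ∘ₗ g ∘ₗ prj S, fun x => (g (prj S x)).2, ?_, fun x => by simp [hpp]⟩
  rintro x ⟨w, hw, hwx⟩ e he
  have hpw : prj S x = f ⟨w, hw⟩ := by
    ext e; by_cases h : e ∈ S
    · simp [f, prj_apply, h, hwx e h]
    · simp [f, prj_apply, h]
  have h1 : f (g (prj S x)) = prj S x := by
    have h2 : g (prj S x) = g0 (f.rangeRestrict ⟨w, hw⟩) := by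
      rw [← hg, hpw]; rfl
    have h3 := congrArg (fun k => (k (f.rangeRestrict ⟨w, hw⟩)).1) hg0
    rw [h2, hpw]
    exact h3
  have := congrFun h1 e
  simpa [f, prj_apply, he] using this

theorem tendsto_pi_prj {E α : Type} [Fintype E] {l : Filter α} (S : Set E) (v : α → E → ℂ)
    (v0 : E → ℂ) (h : ∀ e ∈ S, Tendsto (fun a => v a e) l (𝓝 (v0 e))) :
    Tendsto (fun a => prj S (v a)) l (𝓝 (prj S v0)) := by
  rw [tendsto_pi_nhds]
  intro e
  by_cases he : e ∈ S
  · simpa [prj_apply, he] using h e he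
  · simpa [prj_apply, he] using tendsto_const_nhds

theorem lim_mem {E α : Type} [Fintype E] (L : Submodule ℂ (E → ℂ)) (l : Filter α) [NeBot l]
    (x : α → E → ℂ) (hx : ∀ᶠ a in l, x a ∈ L) (ρ : E → α → ℂ) (lv : E → ℕ) (xt : E → ℂ)
    (h1 : ∀ e, Tendsto (fun a => x a e / ρ e a) l (𝓝 (xt e)))
    (h2 : ∀ e e', lv e = lv e' → ρ e = ρ e')
    (h3 : ∀ e e', lv e < lv e' → Tendsto (fun a => x a e / ρ e' a) l (𝓝 0)) :
    xt ∈ InD L lv := by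
  intro k
  by_cases hk : ∃ e1, lv e1 = k
  swap
  · exact ⟨0, L.zero_mem, fun _ _ => rfl, fun e he => absurd ⟨e, he⟩ hk⟩
  obtain ⟨e1, rfl⟩ := hk
  set k := lv e1 with hkdef
  obtain ⟨σ, hσ1, hσ2, hσ3⟩ := exists_retr L {e | lv e < k}
  let v : α → E → ℂ := fun a => (ρ e1 a)⁻¹ • (x a - σ (x a))
  have hv : ∀ᶠ a in l, v a ∈ Fil L lv k := by
    filter_upwards [hx] with a ha
    refine mem_Fil.2 ⟨L.smul_mem _ (L.sub_mem ha (hσ1 _)), fun e he => ?_⟩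
    have := hσ2 (x a) ⟨x a, ha, fun _ _ => rfl⟩ e he
    simp [v, this]
  have hlim : Tendsto (fun a => prj {e | lv e = k} (v a)) l (𝓝 (prj {e | lv e = k} xt)) := by
    have e1' : ∀ a, prj {e | lv e = k} (v a) = prj {e | lv e = k} ((ρ e1 a)⁻¹ • x a)
        - prj {e | lv e = k} (σ (prj {e | lv e < k} ((ρ e1 a)⁻¹ • x a))) := by
      intro a
      rw [hσ3, map_smul σ, ← map_sub, ← smul_sub]
    simp_rw [e1']
    have ha : Tendsto (fun a => prj {e | lv e = k} ((ρ e1 a)⁻¹ • x a)) l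
        (𝓝 (prj {e | lv e = k} xt)) := by
      apply tendsto_pi_prj
      intro e he
      have := h1 e
      rw [h2 e e1 he] at this
      refine this.congr fun a => ?_
      simp [div_eq_inv_mul]
    have hb : Tendsto (fun a => prj {e | lv e < k} ((ρ e1 a)⁻¹ • x a)) l
        (𝓝 (prj {e | lv e < k} 0)) := by
      apply tendsto_pi_prj
      intro e he
      refine (h3 e e1 he).congr fun a => ?_
      simp [div_eq_inv_mul]
    have hc : Continuous ((prj {e | lv e = k}).comp σ) := LinearMap.continuous_of_finiteDimensional _
    have hd := ha.sub ((hc.tendsto _).comp hb)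
    simpa using hd
  have hcl : IsClosed (((Fil L lv k).map (prj {e | lv e = k}) : Submodule ℂ (E → ℂ)) : Set (E → ℂ)) :=
    Submodule.closed_of_finiteDimensional _
  obtain ⟨w, hw, hwx⟩ := hcl.mem_of_tendsto hlim (hv.mono fun a ha => ⟨v a, ha, rfl⟩)
  obtain ⟨hwL, hw0⟩ := mem_Fil.1 hw
  refine ⟨w, hwL, hw0, fun e he => ?_⟩
  simpa [prj_apply, he] using congrFun hwx e

/-! two-level degeneration -/

def lvl {E : Type} (A : Set E) : E → ℕ := fun e => if e ∈ A then 1 else 0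

theorem mem_InD_lvl {E : Type} {L : Submodule ℂ (E → ℂ)} {A : Set E} {x : E → ℂ} :
    x ∈ InD L (lvl A) ↔ prj A x ∈ L ∧ ∃ w ∈ L, ∀ e ∈ Aᶜ, w e = x e := by
  constructor
  · intro h
    constructor
    · obtain ⟨w, hw, h1, h2⟩ := h 1
      have : prj A x = w := by
        ext e; by_cases he : e ∈ A
        · simp [prj_apply, he, h2 e (by simp [lvl, he])]
        · simp [prj_apply, he, h1 e (by simp [lvl, he])]
      rwa [this]
    · obtain ⟨w, hw, h1, h2⟩ := h 0
      exact ⟨w, hw, fun e he => h2 e (by simpa [lvl] using he)⟩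
  · rintro ⟨h1, w, hw, h2⟩ k
    rcases k with _ | _ | k
    · exact ⟨w, hw, fun e he => absurd he (by simp), fun e he => h2 e (by
        by_contra h; simp at h; simp [lvl, h] at he)⟩
    · refine ⟨_, h1, fun e he => ?_, fun e he => ?_⟩
      · have : e ∉ A := by intro h; simp [lvl, h] at he
        simp [prj_apply, this]
      · have : e ∈ A := by by_contra h; simp [lvl, h] at he
        simp [prj_apply, this]
    · refine ⟨0, L.zero_mem, fun _ _ => rfl, fun e he => ?_⟩
      exfalso; unfold lvl at he; split_ifs at he <;> omega

/-- scale the coordinates in `A` by `c`. -/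
def dil {E : Type} (A : Set E) (c : ℂ) (x : E → ℂ) : E → ℂ := fun e => if e ∈ A then c * x e else x e

theorem dil_mem_iff {E : Type} [Fintype E] {L : Submodule ℂ (E → ℂ)} {A : Set E}
    {σ : (E → ℂ) →ₗ[ℂ] (E → ℂ)} (hσ1 : ∀ x, σ x ∈ L)
    (hσ2 : ∀ x, (∃ w ∈ L, ∀ e ∈ Aᶜ, w e = x e) → ∀ e ∈ Aᶜ, σ x e = x e)
    (ε : ℂ) (hε : ε ≠ 0) (x : E → ℂ) :
    dil A ε⁻¹ (x + ε • prj A (σ x)) ∈ L ↔ x ∈ InD L (lvl A) := by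
  rw [mem_InD_lvl]
  have key : (∀ e ∈ Aᶜ, σ x e = x e) → dil A ε⁻¹ (x + ε • prj A (σ x)) = ε⁻¹ • prj A x + σ x := by
    intro h
    ext e
    by_cases he : e ∈ A
    · simp [dil, prj_apply, he]; field_simp
    · simp [dil, prj_apply, he, h e he]
  constructor
  · intro h
    have hw : ∃ w ∈ L, ∀ e ∈ Aᶜ, w e = x e :=
      ⟨_, h, fun e he => by
        have he' : e ∉ A := he
        simp [dil, he', prj_apply]⟩
    refine ⟨?_, hw⟩
    rw [key (hσ2 x hw)] at h
    have h4 := L.smul_mem ε (L.sub_mem h (hσ1 x))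
    simpa [smul_smul, hε] using h4
  · rintro ⟨h1, hw⟩
    rw [key (hσ2 x hw)]
    exact L.add_mem (L.smul_mem _ h1) (hσ1 x)

theorem finrank_InD_lvl {E : Type} [Fintype E] (L : Submodule ℂ (E → ℂ)) (A : Set E) :
    Module.finrank ℂ (InD L (lvl A)) = Module.finrank ℂ L := by
  apply le_antisymm (finrank_InD_le _ _)
  obtain ⟨σ, hσ1, hσ2, hσ3⟩ := exists_retr L Aᶜ
  -- the inverse map sends L into InD
  let f : L →ₗ[ℂ] (E → ℂ) := (LinearMap.id - (prj A).comp σ).comp L.subtype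
  have hσA : ∀ x, σ (prj A x) = 0 := by
    intro x
    rw [← hσ3]
    have : prj Aᶜ (prj A x) = 0 := by
      ext e; by_cases he : e ∈ A <;> simp [prj_apply, he]
    rw [this, map_zero]
  have hf : ∀ x : L, f x ∈ InD L (lvl A) := by
    intro x
    rw [← dil_mem_iff hσ1 hσ2 1 one_ne_zero]
    have : dil A 1⁻¹ (f x + (1:ℂ) • prj A (σ (f x))) = x.1 := by
      ext e; simp [dil, f, hσA]
    rw [this]; exact x.2
  have hinj : Function.Injective (f.codRestrict _ hf) := by
    rw [injective_iff_map_eq_zero]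
    intro x hx
    have hx' : x.1 - prj A (σ x.1) = 0 := congrArg Subtype.val hx
    have h2 : x.1 = prj A (σ x.1) := sub_eq_zero.1 hx'
    have h3 : σ x.1 = 0 := by rw [h2, hσA]
    rw [h3, map_zero] at h2
    exact Subtype.ext h2
  exact LinearMap.finrank_le_finrank_of_injective hinj



theorem ift_core {ι : Type} [Fintype ι] {T : Type} [NormedAddCommGroup T] [NormedSpace ℂ T]
    [FiniteDimensional ℂ T] (hdim : Fintype.card ι ≤ Module.finrank ℂ T)
    (qX qY sX sY : ι → T →L[ℂ] ℂ) (x0 y0 a0 b0 : ι → ℂ)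
    (hinj : ∀ s, (∀ i, qX i s * y0 i + x0 i * qY i s = 0) → s = 0) :
    ∃ v : ℂ → T, Tendsto v (𝓝 0) (𝓝 0) ∧
      (∀ᶠ ε in 𝓝 (0:ℂ), ∀ i, (x0 i + qX i (v ε) + ε * (a0 i + sX i (v ε))) *
        (y0 i + qY i (v ε) + ε * (b0 i + sY i (v ε))) = x0 i * y0 i) ∧
      (∀ (l : Filter ℂ) (w : ℂ → T), l ≤ 𝓝 0 → Tendsto w l (𝓝 0) →
        (∀ᶠ ε in l, ∀ i, (x0 i + qX i (w ε) + ε * (a0 i + sX i (w ε))) *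
        (y0 i + qY i (w ε) + ε * (b0 i + sY i (w ε))) = x0 i * y0 i) →
        ∀ᶠ ε in l, w ε = v ε) := by
  let f : ℂ × T → ℂ × (ι → ℂ) := fun z => (z.1, fun i =>
    (x0 i + qX i z.2 + z.1 * (a0 i + sX i z.2)) * (y0 i + qY i z.2 + z.1 * (b0 i + sY i z.2)))
  let fs := ContinuousLinearMap.fst ℂ ℂ T
  let sn := ContinuousLinearMap.snd ℂ ℂ T
  let dA : ∀ (q s : ι → T →L[ℂ] ℂ) (a : ι → ℂ) (i : ι), ℂ × T →L[ℂ] ℂ := fun q s a i =>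
    (q i).comp sn + a i • fs
  let f' : ℂ × T →L[ℂ] ℂ × (ι → ℂ) := fs.prod (ContinuousLinearMap.pi fun i =>
    x0 i • dA qY sY b0 i + y0 i • dA qX sX a0 i)
  have hA : ∀ (q s : ι → T →L[ℂ] ℂ) (x a : ι → ℂ) (i : ι),
      HasStrictFDerivAt (fun z : ℂ × T => x i + q i z.2 + z.1 * (a i + s i z.2)) (dA q s a i) 0 := by
    intro q s x a i
    have h1 : HasStrictFDerivAt (fun z : ℂ × T => x i + q i z.2) ((q i).comp sn) 0 :=
      ((q i).comp sn).hasStrictFDerivAt.const_add (x i)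
    have h2 : HasStrictFDerivAt (fun z : ℂ × T => a i + s i z.2) ((s i).comp sn) 0 :=
      ((s i).comp sn).hasStrictFDerivAt.const_add (a i)
    have h3 : HasStrictFDerivAt (fun z : ℂ × T => z.1) fs 0 := fs.hasStrictFDerivAt
    have h4 := h1.add (h3.mul h2)
    refine h4.congr_fderiv ?_
    ext z <;> simp [dA, fs, sn]
  have hf : HasStrictFDerivAt f f' 0 := by
    have h3 : HasStrictFDerivAt (fun z : ℂ × T => z.1) fs 0 := fs.hasStrictFDerivAt
    refine h3.prodMk ?_
    rw [hasStrictFDerivAt_pi']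
    intro i
    have := (hA qX sX x0 a0 i).mul (hA qY sY y0 b0 i)
    refine this.congr_fderiv ?_
    ext z <;> simp 
  have hker : ∀ z, f' z = 0 → z = 0 := by
    rintro ⟨d, s⟩ hz
    have hd : d = 0 := congrArg Prod.fst hz
    have hs : ∀ i, _ := fun i => congrFun (congrArg Prod.snd hz) i
    subst hd
    have : s = 0 := hinj s fun i => by
      have := hs i
      simp only [f', dA, fs, sn, ContinuousLinearMap.prod_apply, ContinuousLinearMap.coe_pi',
        add_apply, smul_apply, ContinuousLinearMap.comp_apply, ContinuousLinearMap.coe_snd',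
        ContinuousLinearMap.coe_fst', smul_eq_mul] at this
      simp at this
      linear_combination this
    rw [this]; rfl
  have hinj' : Function.Injective f'.toLinearMap := by
    rw [injective_iff_map_eq_zero]; exact hker
  have hfr : Module.finrank ℂ (ℂ × T) = Module.finrank ℂ (ℂ × (ι → ℂ)) := by
    have := LinearMap.finrank_le_finrank_of_injective hinj'
    apply le_antisymm this
    simp; exact hdim
  let g : (ℂ × T) ≃L[ℂ] (ℂ × (ι → ℂ)) :=
    (LinearEquiv.ofInjectiveOfFinrankEq f'.toLinearMap hinj' hfr).toContinuousLinearEquiv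
  have hg : (g : (ℂ × T) →L[ℂ] (ℂ × (ι → ℂ))) = f' := by ext z <;> rfl
  rw [← hg] at hf
  let inv := hf.localInverse f g 0
  have hf0 : f 0 = (0, fun i => x0 i * y0 i) := by simp [f]
  have hR : ∀ᶠ y in 𝓝 (f 0), f (inv y) = y := hf.eventually_right_inverse
  have hL : ∀ᶠ z in 𝓝 0, inv (f z) = z := hf.eventually_left_inverse
  have hT : Tendsto inv (𝓝 (f 0)) (𝓝 0) := hf.localInverse_tendsto
  have hc : Tendsto (fun ε : ℂ => ((ε, fun i => x0 i * y0 i) : ℂ × (ι → ℂ))) (𝓝 0) (𝓝 (f 0)) := by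
    rw [hf0]
    exact (Continuous.prodMk continuous_id continuous_const).tendsto _
  refine ⟨fun ε => (inv (ε, fun i => x0 i * y0 i)).2, ?_, ?_, ?_⟩
  · exact (continuous_snd.tendsto (0 : ℂ × T)).comp (hT.comp hc)
  · filter_upwards [hc.eventually hR] with ε hε i
    have h1 : (inv (ε, fun i => x0 i * y0 i)).1 = ε := congrArg Prod.fst hε
    have h2 := congrFun (congrArg Prod.snd hε) i
    simp only [f] at h2
    rw [h1] at h2
    exact h2
  · intro l w hl hw h
    have hz : Tendsto (fun ε => ((ε, w ε) : ℂ × T)) l (𝓝 0) :=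
      (tendsto_id.mono_left hl).prodMk_nhds hw
    filter_upwards [hz.eventually hL, h] with ε h1 h2
    have : f (ε, w ε) = (ε, fun i => x0 i * y0 i) := by
      refine Prod.ext rfl (funext fun i => ?_)
      exact h2 i
    rw [this] at h1
    rw [h1]



theorem finrank_hyper {E : Type} [Fintype E] (P : Submodule ℂ (E → ℂ)) (b : E) :
    Module.finrank ℂ P ≤ Module.finrank ℂ (P ⊓ LinearMap.ker (LinearMap.proj b) : Submodule ℂ (E → ℂ)) + 1 := by
  let f : P →ₗ[ℂ] ℂ := (LinearMap.proj b).comp P.subtype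
  have h := LinearMap.finrank_range_add_finrank_ker f
  have h1 : Module.finrank ℂ (LinearMap.range f) ≤ 1 := by
    have := Submodule.finrank_le (LinearMap.range f); simpa using this
  have h2 : Module.finrank ℂ (LinearMap.ker f) ≤
      Module.finrank ℂ (P ⊓ LinearMap.ker (LinearMap.proj b) : Submodule ℂ (E → ℂ)) := by
    let g : LinearMap.ker f →ₗ[ℂ] (E → ℂ) := P.subtype.comp (LinearMap.ker f).subtype
    have hg : ∀ x, g x ∈ (P ⊓ LinearMap.ker (LinearMap.proj b) : Submodule ℂ (E → ℂ)) :=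
      fun x => ⟨x.1.2, x.2⟩
    apply LinearMap.finrank_le_finrank_of_injective (f := g.codRestrict _ hg)
    intro x y hxy
    have := congrArg Subtype.val hxy
    exact Subtype.ext (Subtype.ext this)
  omega

theorem dil_dil {E : Type} (A : Set E) (c : ℂ) (hc : c ≠ 0) (x : E → ℂ) :
    dil A c (dil A c⁻¹ x) = x := by
  ext e; by_cases h : e ∈ A <;> simp [dil, h, hc]

theorem dil_dil' {E : Type} (A : Set E) (c : ℂ) (hc : c ≠ 0) (x : E → ℂ) :
    dil A c⁻¹ (dil A c x) = x := by
  ext e; by_cases h : e ∈ A <;> simp [dil, h, hc]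

theorem retr_prj {E : Type} {A : Set E}
    {σ : (E → ℂ) →ₗ[ℂ] (E → ℂ)} (hσ3 : ∀ x, σ (prj Aᶜ x) = σ x) (x : E → ℂ) : σ (prj A x) = 0 := by
  rw [← hσ3]
  have : prj Aᶜ (prj A x) = 0 := by
    ext e; by_cases he : e ∈ A <;> simp [prj_apply, he]
  rw [this, map_zero]

theorem degen_ift {E : Type} [Fintype E] (L L' : Submodule ℂ (E → ℂ)) (b : E)
    (hdim : Fintype.card E + 1 ≤ Module.finrank ℂ L + Module.finrank ℂ L')
    (A C : Set E) (hbA : b ∉ A) (hC : C = (insert b A)ᶜ) (mu : {e : E // e ≠ b} → ℂ)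
    (hInj : InjAt (InD L (lvl A)) (InD L' (lvl C)) b mu) (z0 : (E → ℂ) × (E → ℂ))
    (hz0 : z0 ∈ Zl (InD L (lvl A)) (InD L' (lvl C)) b mu) :
    ∃ ξ : ℂ → (E → ℂ) × (E → ℂ), (∀ᶠ ε in 𝓝[≠] (0:ℂ), ξ ε ∈ Zl L L' b (ε⁻¹ • mu)) ∧
      Tendsto (fun ε => dil A ε (ξ ε).1) (𝓝[≠] 0) (𝓝 z0.1) ∧
      Tendsto (fun ε => dil C ε (ξ ε).2) (𝓝[≠] 0) (𝓝 z0.2) ∧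
      ∀ (l : Filter ℂ) (ξ' : ℂ → (E → ℂ) × (E → ℂ)), l ≤ 𝓝[≠] 0 →
        (∀ᶠ ε in l, ξ' ε ∈ Zl L L' b (ε⁻¹ • mu)) →
        Tendsto (fun ε => dil A ε (ξ' ε).1) l (𝓝 z0.1) →
        Tendsto (fun ε => dil C ε (ξ' ε).2) l (𝓝 z0.2) → ∀ᶠ ε in l, ξ' ε = ξ ε := by
  have hbC : b ∉ C := by simp [hC]
  obtain ⟨σ, hσ1, hσ2, hσ3⟩ := exists_retr L Aᶜ
  obtain ⟨σ', hσ1', hσ2', hσ3'⟩ := exists_retr L' Cᶜ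
  have hσA := retr_prj hσ3
  have hσC := retr_prj hσ3'
  obtain ⟨x0, y0⟩ := z0
  obtain ⟨hx0, hy0, hxb, hyb, hxy⟩ := id hz0
  simp only at hx0 hy0 hxb hyb hxy
  set P := InD L (lvl A) with hP
  set Q := InD L' (lvl C) with hQ
  let P0 : Submodule ℂ (E → ℂ) := P ⊓ LinearMap.ker (LinearMap.proj b)
  let Q0 : Submodule ℂ (E → ℂ) := Q ⊓ LinearMap.ker (LinearMap.proj b)
  have hP0 : ∀ x, x ∈ P0 ↔ x ∈ P ∧ x b = 0 := fun x => Iff.rfl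
  have hQ0 : ∀ x, x ∈ Q0 ↔ x ∈ Q ∧ x b = 0 := fun x => Iff.rfl
  obtain ⟨πP, hπP⟩ := LinearMap.exists_leftInverse_of_injective P0.subtype (by simp)
  obtain ⟨πQ, hπQ⟩ := LinearMap.exists_leftInverse_of_injective Q0.subtype (by simp)
  have hπP' : ∀ x : P0, πP x.1 = x := fun x => LinearMap.congr_fun hπP x
  have hπQ' : ∀ x : Q0, πQ x.1 = x := fun x => LinearMap.congr_fun hπQ x
  have hcard : Fintype.card {e : E // e ≠ b} + 1 = Fintype.card E := by
    rw [Fintype.card_subtype_compl]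
    simp
    have : 0 < Fintype.card E := Fintype.card_pos_iff.2 ⟨b⟩
    omega
  have hd : Fintype.card {e : E // e ≠ b} ≤ Module.finrank ℂ (P0 × Q0) := by
    rw [Module.finrank_prod]
    have h1 := finrank_hyper P b
    have h2 := finrank_hyper Q b
    rw [hP, finrank_InD_lvl] at h1
    rw [hQ, finrank_InD_lvl] at h2
    change Module.finrank ℂ L ≤ Module.finrank ℂ P0 + 1 at h1
    change Module.finrank ℂ L' ≤ Module.finrank ℂ Q0 + 1 at h2
    omega
  obtain ⟨v, hv1, hv2, hv3⟩ := ift_core (ι := {e : E // e ≠ b}) (T := P0 × Q0) hd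
    (fun e => LinearMap.toContinuousLinearMap
      ((LinearMap.proj e.1).comp (P0.subtype.comp (LinearMap.fst ℂ P0 Q0))))
    (fun e => LinearMap.toContinuousLinearMap
      ((LinearMap.proj e.1).comp (Q0.subtype.comp (LinearMap.snd ℂ P0 Q0))))
    (fun e => LinearMap.toContinuousLinearMap
      ((LinearMap.proj e.1).comp ((prj A).comp (σ.comp (P0.subtype.comp (LinearMap.fst ℂ P0 Q0))))))
    (fun e => LinearMap.toContinuousLinearMap
      ((LinearMap.proj e.1).comp ((prj C).comp (σ'.comp (Q0.subtype.comp (LinearMap.snd ℂ P0 Q0))))))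
    (fun e => x0 e) (fun e => y0 e) (fun e => prj A (σ x0) e) (fun e => prj C (σ' y0) e) (by
      rintro ⟨u, w⟩ h
      have := hInj (x0, y0) hz0 u.1 u.2.1 w.1 w.2.1 u.2.2 w.2.2 (fun e => h e)
      exact Prod.ext (Subtype.ext this.1) (Subtype.ext this.2))
  simp only [LinearMap.coe_toContinuousLinearMap', LinearMap.comp_apply, LinearMap.proj_apply,
    Submodule.subtype_apply, LinearMap.fst_apply, LinearMap.snd_apply] at hv2 hv3
  have hne : ∀ᶠ ε in 𝓝[≠] (0:ℂ), ε ≠ 0 := eventually_mem_nhdsWithin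
  let Ψ : ℂ → (E → ℂ) → (E → ℂ) := fun ε x => x + ε • prj A (σ x)
  let Ψ' : ℂ → (E → ℂ) → (E → ℂ) := fun ε x => x + ε • prj C (σ' x)
  -- products
  have hprod : ∀ (ε : ℂ) (hε : ε ≠ 0) (X Y : E → ℂ) (e : {e : E // e ≠ b}),
      dil A ε⁻¹ X e * dil C ε⁻¹ Y e = ε⁻¹ * (X e * Y e) := by
    intro ε hε X Y e
    by_cases he : e.1 ∈ A
    · have : e.1 ∉ C := by simp [hC, he]
      simp only [dil, he, this, if_true, if_false]; ring
    · have : e.1 ∈ C := by simp [hC, he, e.2]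
      simp only [dil, he, this, if_true, if_false]; ring
  let ξ : ℂ → (E → ℂ) × (E → ℂ) := fun ε =>
    (dil A ε⁻¹ (Ψ ε (x0 + (v ε).1.1)), dil C ε⁻¹ (Ψ' ε (y0 + (v ε).2.1)))
  refine ⟨ξ, ?_, ?_, ?_, ?_⟩
  · filter_upwards [hne, hv2.filter_mono nhdsWithin_le_nhds] with ε hε h
    refine ⟨?_, ?_, ?_, ?_, ?_⟩
    · exact (dil_mem_iff hσ1 hσ2 ε hε _).2 (P.add_mem hx0 (v ε).1.2.1)
    · exact (dil_mem_iff hσ1' hσ2' ε hε _).2 (Q.add_mem hy0 (v ε).2.2.1)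
    · have : (v ε).1.1 b = 0 := (v ε).1.2.2
      simp [ξ, dil, hbA, Ψ, prj_apply, hxb, this]
    · have : (v ε).2.1 b = 0 := (v ε).2.2.2
      simp [ξ, dil, hbC, Ψ', prj_apply, hyb, this]
    · intro e
      rw [hprod ε hε]
      have := h e
      rw [hxy e] at this
      simp only [Ψ, Ψ', Pi.add_apply, Pi.smul_apply, map_add, smul_eq_mul]
      rw [this]
  · have h1 : Tendsto (fun ε => Ψ ε (x0 + (v ε).1.1)) (𝓝[≠] 0) (𝓝 x0) := by
      have h2 : Tendsto (fun ε => x0 + (v ε).1.1) (𝓝[≠] 0) (𝓝 (x0 + 0)) := by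
        refine tendsto_const_nhds.add ?_
        exact ((continuous_subtype_val.comp continuous_fst).tendsto (0 : P0 × Q0)).comp
          (hv1.mono_left nhdsWithin_le_nhds)
      have hc : Continuous ((prj A).comp σ) := LinearMap.continuous_of_finiteDimensional _
      have h3 : Tendsto (fun ε : ℂ => ε) (𝓝[≠] 0) (𝓝 0) := nhdsWithin_le_nhds
      have h4 := h2.add (h3.smul ((hc.tendsto _).comp h2))
      simpa [Ψ, Ψ'] using h4
    refine h1.congr' ?_
    filter_upwards [hne] with ε hε
    simp only [ξ]; rw [dil_dil _ _ hε]
  · have h1 : Tendsto (fun ε => Ψ' ε (y0 + (v ε).2.1)) (𝓝[≠] 0) (𝓝 y0) := by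
      have h2 : Tendsto (fun ε => y0 + (v ε).2.1) (𝓝[≠] 0) (𝓝 (y0 + 0)) := by
        refine tendsto_const_nhds.add ?_
        exact ((continuous_subtype_val.comp continuous_snd).tendsto (0 : P0 × Q0)).comp
          (hv1.mono_left nhdsWithin_le_nhds)
      have hc : Continuous ((prj C).comp σ') := LinearMap.continuous_of_finiteDimensional _
      have h3 : Tendsto (fun ε : ℂ => ε) (𝓝[≠] 0) (𝓝 0) := nhdsWithin_le_nhds
      have h4 := h2.add (h3.smul ((hc.tendsto _).comp h2))
      simpa [Ψ, Ψ'] using h4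
    refine h1.congr' ?_
    filter_upwards [hne] with ε hε
    simp only [ξ]; rw [dil_dil _ _ hε]
  · intro l ξ' hl hξ' ht1 ht2
    have hl0 : l ≤ 𝓝 0 := hl.trans nhdsWithin_le_nhds
    have ht0 : Tendsto (fun ε : ℂ => ε) l (𝓝 0) := hl0
    let X : ℂ → E → ℂ := fun ε => dil A ε (ξ' ε).1 - ε • prj A (σ (dil A ε (ξ' ε).1))
    let Y : ℂ → E → ℂ := fun ε => dil C ε (ξ' ε).2 - ε • prj C (σ' (dil C ε (ξ' ε).2))
    have hX : Tendsto X l (𝓝 x0) := by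
      have hc : Continuous ((prj A).comp σ) := LinearMap.continuous_of_finiteDimensional _
      have h4 := ht1.sub (ht0.smul ((hc.tendsto _).comp ht1))
      simpa using h4
    have hY : Tendsto Y l (𝓝 y0) := by
      have hc : Continuous ((prj C).comp σ') := LinearMap.continuous_of_finiteDimensional _
      have h4 := ht2.sub (ht0.smul ((hc.tendsto _).comp ht2))
      simpa using h4
    have hΨX : ∀ ε, Ψ ε (X ε) = dil A ε (ξ' ε).1 := by
      intro ε; simp [Ψ, X, hσA]
    have hΨY : ∀ ε, Ψ' ε (Y ε) = dil C ε (ξ' ε).2 := by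
      intro ε; simp [Ψ', Y, hσC]
    let w : ℂ → P0 × Q0 := fun ε => (πP (X ε - x0), πQ (Y ε - y0))
    have hmem : ∀ᶠ ε in l, (w ε).1.1 = X ε - x0 ∧ (w ε).2.1 = Y ε - y0 := by
      filter_upwards [hξ', hl hne] with ε hz hε
      obtain ⟨g1, g2, g3, g4, g5⟩ := hz
      have k1 : X ε - x0 ∈ P0 := by
        rw [hP0]
        refine ⟨P.sub_mem ((dil_mem_iff hσ1 hσ2 ε hε _).1 ?_) hx0, ?_⟩
        · change dil A ε⁻¹ (Ψ ε (X ε)) ∈ L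
          rw [hΨX, dil_dil' _ _ hε]; exact g1
        · simp [X, dil, hbA, prj_apply, g3, hxb]
      have k2 : Y ε - y0 ∈ Q0 := by
        rw [hQ0]
        refine ⟨Q.sub_mem ((dil_mem_iff hσ1' hσ2' ε hε _).1 ?_) hy0, ?_⟩
        · change dil C ε⁻¹ (Ψ' ε (Y ε)) ∈ L'
          rw [hΨY, dil_dil' _ _ hε]; exact g2
        · simp [Y, dil, hbC, prj_apply, g4, hyb]
      exact ⟨congrArg Subtype.val (hπP' ⟨_, k1⟩), congrArg Subtype.val (hπQ' ⟨_, k2⟩)⟩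
    have hw : Tendsto w l (𝓝 0) := by
      have c1 : Continuous πP := LinearMap.continuous_of_finiteDimensional _
      have c2 : Continuous πQ := LinearMap.continuous_of_finiteDimensional _
      have t1 := (c1.tendsto _).comp (hX.sub (tendsto_const_nhds (x := x0)))
      have t2 := (c2.tendsto _).comp (hY.sub (tendsto_const_nhds (x := y0)))
      have := t1.prodMk_nhds t2
      rw [sub_self, sub_self, map_zero, map_zero] at this
      exact this
    have key := hv3 l w hl0 hw (by
      filter_upwards [hmem, hξ', hl hne] with ε ⟨m1, m2⟩ hz hε e
      obtain ⟨g1, g2, g3, g4, g5⟩ := hz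
      rw [m1, m2]
      have e1 : x0 e.1 + (X ε - x0) e.1 + ε * (prj A (σ x0) e.1 + prj A (σ (X ε - x0)) e.1)
          = Ψ ε (X ε) e.1 := by simp [Ψ]
      have e2 : y0 e.1 + (Y ε - y0) e.1 + ε * (prj C (σ' y0) e.1 + prj C (σ' (Y ε - y0)) e.1)
          = Ψ' ε (Y ε) e.1 := by simp [Ψ']
      rw [e1, e2, hΨX, hΨY, hxy e]
      have h := hprod ε hε (dil A ε (ξ' ε).1) (dil C ε (ξ' ε).2) e
      rw [dil_dil' _ _ hε, dil_dil' _ _ hε, g5 e] at h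
      simp only [Pi.smul_apply, smul_eq_mul] at h
      exact (mul_left_cancel₀ (inv_ne_zero hε) h).symm)
    filter_upwards [key, hmem, hl hne] with ε k ⟨m1, m2⟩ hε
    simp only [ξ]
    rw [← k, m1, m2]
    simp only [add_sub_cancel, hΨX, hΨY]
    rw [dil_dil' _ _ hε, dil_dil' _ _ hε]



theorem ultra_tri (U : Ultrafilter ℂ) (f : ℂ → ℂ) :
    (∃ c, Tendsto f U (𝓝 c)) ∨ Tendsto (fun a => (f a)⁻¹) U (𝓝 0) := by
  by_cases h : ∃ R : ℝ, ∀ᶠ a in (U : Filter ℂ), ‖f a‖ ≤ R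
  · left
    obtain ⟨R, hR⟩ := h
    have hc : IsCompact (Metric.closedBall (0:ℂ) R) := isCompact_closedBall _ _
    obtain ⟨c, -, hc⟩ := hc.ultrafilter_le_nhds (U.map f) (by
      rw [le_principal_iff]
      change f ⁻¹' _ ∈ (U : Filter ℂ)
      filter_upwards [hR] with a ha
      simpa using ha)
    exact ⟨c, hc⟩
  · right
    push Not at h
    have h2 : ∀ R : ℝ, ∀ᶠ a in (U : Filter ℂ), R ≤ ‖f a‖ := by
      intro R
      filter_upwards [h R] with a ha using le_of_lt ha
    have h3 : Tendsto (fun a => ‖f a‖) U atTop := tendsto_atTop.2 h2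
    have h4 := (tendsto_norm_atTop_iff_cobounded.1 h3)
    exact tendsto_inv₀_cobounded.comp h4

/-- Scales along an ultrafilter. -/
theorem scales (U : Ultrafilter ℂ) {I : Type} [Fintype I] (F : I → ℂ → ℂ)
    (hF : ∀ i, ∀ᶠ a in (U : Filter ℂ), F i a ≠ 0) :
    ∃ lv : I → ℕ, (∀ i, lv i ≤ Fintype.card I) ∧
      (∀ i j, lv i < lv j ↔ Tendsto (fun a => F i a / F j a) U (𝓝 0)) ∧
      (∀ i j, lv i = lv j → ∃ c, c ≠ 0 ∧ Tendsto (fun a => F i a / F j a) U (𝓝 c)) := by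
  let R : I → I → Prop := fun i j => Tendsto (fun a => F i a / F j a) U (𝓝 0)
  have tr : ∀ i j k c d, Tendsto (fun a => F i a / F j a) U (𝓝 c) →
      Tendsto (fun a => F j a / F k a) U (𝓝 d) → Tendsto (fun a => F i a / F k a) U (𝓝 (c*d)) := by
    intro i j k c d h1 h2
    refine (h1.mul h2).congr' ?_
    filter_upwards [hF j] with a ha
    field_simp
  have irr : ∀ i, ¬ R i i := by
    intro i hi
    have : Tendsto (fun a => F i a / F i a) U (𝓝 1) := by
      refine tendsto_const_nhds.congr' ?_
      filter_upwards [hF i] with a ha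
      field_simp
    exact zero_ne_one (tendsto_nhds_unique hi this)
  have tri : ∀ i j, R i j ∨ R j i ∨ ∃ c, c ≠ 0 ∧ Tendsto (fun a => F i a / F j a) U (𝓝 c) := by
    intro i j
    rcases ultra_tri U (fun a => F i a / F j a) with ⟨c, hc⟩ | h
    · by_cases h0 : c = 0
      · left; rw [h0] at hc; exact hc
      · exact Or.inr (Or.inr ⟨c, h0, hc⟩)
    · right; left
      simpa using h
  have symm : ∀ i j c, c ≠ 0 → Tendsto (fun a => F i a / F j a) U (𝓝 c) →
      Tendsto (fun a => F j a / F i a) U (𝓝 c⁻¹) := by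
    intro i j c hc h
    simpa using h.inv₀ hc
  let lv : I → ℕ := fun i => (Finset.univ.filter fun j => R j i).card
  have m1 : ∀ i j, R i j → lv i < lv j := by
    intro i j h
    apply Finset.card_lt_card
    rw [Finset.ssubset_iff_of_subset]
    · exact ⟨i, by simpa using h, by simpa using irr i⟩
    · intro k hk
      simp only [Finset.mem_filter, Finset.mem_univ, true_and] at hk ⊢
      have := tr k i j 0 0 hk h
      simpa using this
  have m2 : ∀ i j c, c ≠ 0 → Tendsto (fun a => F i a / F j a) U (𝓝 c) → lv i = lv j := by
    intro i j c hc h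
    have : ∀ k, R k i ↔ R k j := by
      intro k
      constructor
      · intro hk; have := tr k i j 0 c hk h; simpa using this
      · intro hk; have := tr k j i 0 _ hk (symm i j c hc h); simpa using this
    simp only [lv, this]
  refine ⟨lv, fun i => Finset.card_le_univ _, fun i j => ⟨fun h => ?_, m1 i j⟩, fun i j h => ?_⟩
  · rcases tri i j with h1 | h1 | ⟨c, hc, h1⟩
    · exact h1
    · have := m1 j i h1; omega
    · have := m2 i j c hc h1; omega
  · rcases tri i j with h1 | h1 | h1
    · have := m1 i j h1; omega
    · have := m1 j i h1; omega
    · exact h1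

theorem InD_congr {E : Type} {L : Submodule ℂ (E → ℂ)} {l l' : E → ℕ}
    (h : ∀ e e', l' e < l' e' → l e < l e') (h' : ∀ e e', l' e = l' e' → l e = l e') {x : E → ℂ}
    (hx : x ∈ InD L l) : x ∈ InD L l' := by
  intro k
  by_cases hk : ∃ e1, l' e1 = k
  swap
  · exact ⟨0, L.zero_mem, fun _ _ => rfl, fun e he => absurd ⟨e, he⟩ hk⟩
  obtain ⟨e1, rfl⟩ := hk
  obtain ⟨w, hw, h1, h2⟩ := hx (l e1)
  exact ⟨w, hw, fun e he => h1 e (h _ _ he), fun e he => h2 e (h' _ _ he)⟩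

theorem InD_level {E : Type} {L : Submodule ℂ (E → ℂ)} {l : E → ℕ} (j : ℕ) {x : E → ℂ}
    (hx : x ∈ InD L l) : prj {e | l e = j} x ∈ InD L l := by
  intro k
  by_cases hk : k = j
  · obtain ⟨w, hw, h1, h2⟩ := hx k
    refine ⟨w, hw, h1, fun e he => ?_⟩
    simp [prj_apply, he ▸ hk, h2 e he]
  · refine ⟨0, L.zero_mem, fun _ _ => rfl, fun e he => ?_⟩
    have : ¬ (l e = j) := by rw [he]; exact hk
    simp [prj_apply, this]

theorem dichotomy {E : Type} [Fintype E] (L L' : Submodule ℂ (E → ℂ)) (b : E)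
    (mu : {e : E // e ≠ b} → ℂ) (hmu : ∀ e, mu e ≠ 0)
    (hInj : ∀ l l', InjAt (InD L l) (InD L' l') b mu)
    (U : Ultrafilter ℂ) (hU : (U : Filter ℂ) ≤ 𝓝[≠] 0) (ξ : ℂ → (E → ℂ) × (E → ℂ))
    (hξ : ∀ᶠ ε in (U : Filter ℂ), ξ ε ∈ Zl L L' b (ε⁻¹ • mu)) :
    ∃ A : Set E, b ∉ A ∧
      ∃ z ∈ Zl (InD L (lvl A)) (InD L' (lvl (insert b A)ᶜ)) b mu, (∀ e, z.1 e ≠ 0) ∧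
        Tendsto (fun ε => dil A ε (ξ ε).1) U (𝓝 z.1) ∧
        Tendsto (fun ε => dil (insert b A)ᶜ ε (ξ ε).2) U (𝓝 z.2) := by
  have hne : ∀ᶠ ε in (U : Filter ℂ), ε ≠ 0 := hU eventually_mem_nhdsWithin
  have h0 : Tendsto (fun ε : ℂ => ε) U (𝓝 0) := hU.trans nhdsWithin_le_nhds
  -- index type: `inl false` is the constant 1, `inl true` is ε⁻¹
  let F : Bool ⊕ E → ℂ → ℂ := Sum.elim (fun c a => if c then a⁻¹ else 1) (fun e a => (ξ a).1 e)
  have hF : ∀ i, ∀ᶠ a in (U : Filter ℂ), F i a ≠ 0 := by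
    rintro (c | e)
    · filter_upwards [hne] with a ha
      cases c <;> simp [F, ha]
    · filter_upwards [hξ, hne] with a ha ha0
      obtain ⟨g1, g2, g3, g4, g5⟩ := ha
      by_cases he : e = b
      · simp [F, he, g3]
      · have := g5 ⟨e, he⟩
        intro h
        simp only [F, Sum.elim_inr] at h
        simp only [h, zero_mul, Pi.smul_apply, smul_eq_mul] at this
        exact mul_ne_zero (inv_ne_zero ha0) (hmu _) this.symm
  obtain ⟨lv, hM, hlt, heq⟩ := scales U F hF
  set M := Fintype.card (Bool ⊕ E)
  have h1t : lv (.inl false) < lv (.inl true) := by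
    rw [hlt]
    simpa [F] using h0
  -- representatives
  let ρ : ℕ → ℂ → ℂ := fun k => if k = lv (.inl false) then F (.inl false) else
    if k = lv (.inl true) then F (.inl true) else
    if h : ∃ i, lv i = k then F h.choose else 0
  have hρ : ∀ i, ∃ j, lv j = lv i ∧ ρ (lv i) = F j := by
    intro i
    simp only [ρ]
    split_ifs with g1 g2 g3
    · exact ⟨_, g1.symm, rfl⟩
    · exact ⟨_, g2.symm, rfl⟩
    · exact ⟨_, g3.choose_spec, rfl⟩
    · exact absurd ⟨i, rfl⟩ g3
  have hρ1 : ρ (lv (.inl false)) = fun _ => 1 := by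
    simp only [ρ, if_true]; ext a; simp [F]
  have hρt : ρ (lv (.inl true)) = fun a => a⁻¹ := by
    simp only [ρ, if_neg h1t.ne', if_true]; ext a; simp [F]
  have hρne : ∀ i, ∀ᶠ a in (U : Filter ℂ), ρ (lv i) a ≠ 0 := by
    intro i; obtain ⟨j, -, hj⟩ := hρ i; rw [hj]; exact hF j
  have hc : ∀ i, ∃ c, c ≠ 0 ∧ Tendsto (fun a => F i a / ρ (lv i) a) U (𝓝 c) := by
    intro i
    obtain ⟨j, h1, h2⟩ := hρ i
    rw [h2]; exact heq i j h1.symm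
  choose c hc0 hc using hc
  have hlow : ∀ i j, lv i < lv j → Tendsto (fun a => F i a / ρ (lv j) a) U (𝓝 0) := by
    intro i j h
    obtain ⟨k, h1, h2⟩ := hρ j
    rw [h2]; exact (hlt i k).1 (h1 ▸ h)
  have hlow' : ∀ i j, lv i < lv j → Tendsto (fun a => ρ (lv i) a / F j a) U (𝓝 0) := by
    intro i j h
    obtain ⟨k, h1, h2⟩ := hρ i
    rw [h2]; exact (hlt k j).1 (h1 ▸ h)
  have hlvb : lv (.inr b) = lv (.inl false) := by
    have h1 : Tendsto (fun a => F (.inr b) a / F (.inl false) a) U (𝓝 1) := by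
      refine tendsto_const_nhds.congr' ?_
      filter_upwards [hξ] with a ha
      simp [F, ha.2.2.1]
    have h2 : Tendsto (fun a => F (.inl false) a / F (.inr b) a) U (𝓝 1) := by
      refine tendsto_const_nhds.congr' ?_
      filter_upwards [hξ] with a ha
      simp [F, ha.2.2.1]
    rcases lt_trichotomy (lv (.inr b)) (lv (.inl false)) with h | h | h
    · exact absurd (tendsto_nhds_unique ((hlt _ _).1 h) h1) zero_ne_one
    · exact h
    · exact absurd (tendsto_nhds_unique ((hlt _ _).1 h) h2) zero_ne_one
  -- y side
  let ip : E → Bool ⊕ E := fun e => if e = b then .inl true else .inr e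
  let m : E → ℂ := fun e => if h : e = b then 1 else mu ⟨e, h⟩
  have hy : ∀ e, ∀ᶠ a in (U : Filter ℂ), (ξ a).2 e = m e * a⁻¹ / F (ip e) a := by
    intro e
    filter_upwards [hξ, hne, hF (ip e)] with a ha ha0 hf
    obtain ⟨g1, g2, g3, g4, g5⟩ := ha
    by_cases he : e = b
    · subst he
      simp [ip, m, F, g4, ha0]
    · have := g5 ⟨e, he⟩
      rw [eq_div_iff hf]
      simp only [ip, m, if_neg he, dif_neg he, F, Sum.elim_inr]
      simp only [Pi.smul_apply, smul_eq_mul] at this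
      linear_combination this
  let ρ' : E → ℂ → ℂ := fun e a => a⁻¹ / ρ (lv (ip e)) a
  let xt : E → ℂ := fun e => c (.inr e)
  let yt : E → ℂ := fun e => m e * (c (ip e))⁻¹
  have hxt : ∀ e, Tendsto (fun a => (ξ a).1 e / ρ (lv (.inr e)) a) U (𝓝 (xt e)) :=
    fun e => hc (.inr e)
  have hyt : ∀ e, Tendsto (fun a => (ξ a).2 e / ρ' e a) U (𝓝 (yt e)) := by
    intro e
    refine (tendsto_const_nhds.mul ((hc (ip e)).inv₀ (hc0 _))).congr' ?_
    filter_upwards [hy e, hne, hF (ip e), hρne (ip e)] with a h1 h2 h3 h4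
    rw [h1]; simp only [ρ']; field_simp
  have hxI : xt ∈ InD L (fun e => lv (.inr e)) := by
    refine lim_mem L U (fun a => (ξ a).1) (hξ.mono fun a ha => ha.1)
      (fun e => ρ (lv (.inr e))) _ xt hxt ?_ ?_
    · intro e e' h; rw [h]
    · intro e e' h; exact hlow _ _ h
  have hyI : yt ∈ InD L' (fun e => M - lv (ip e)) := by
    refine lim_mem L' U (fun a => (ξ a).2) (hξ.mono fun a ha => ha.2.1)
      ρ' _ yt hyt ?_ ?_
    · intro e e' h
      have := hM (ip e); have := hM (ip e')
      have : lv (ip e) = lv (ip e') := by omega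
      simp only [ρ', this]
    · intro e e' h
      have := hM (ip e); have := hM (ip e')
      have : lv (ip e') < lv (ip e) := by omega
      have h2 := (hlow' _ _ this).const_mul (m e)
      rw [mul_zero] at h2
      refine h2.congr' ?_
      filter_upwards [hy e, hne, hF (ip e), hρne (ip e')] with a h1 h2 h3 h4
      rw [h1]; simp only [ρ']; field_simp
  have hxb : xt b = 1 := by
    refine tendsto_nhds_unique (hxt b) ?_
    refine tendsto_const_nhds.congr' ?_
    filter_upwards [hξ] with a ha
    rw [hlvb, hρ1, ha.2.2.1]; simp
  have hipb : ip b = .inl true := by simp [ip]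
  have hip : ∀ e, e ≠ b → ip e = .inr e := fun e he => by simp [ip, he]
  have hyb : yt b = 1 := by
    refine tendsto_nhds_unique (hyt b) ?_
    refine tendsto_const_nhds.congr' ?_
    filter_upwards [hξ, hne] with a ha ha0
    simp only [ρ', hipb]
    rw [hρt, ha.2.2.2.1]; simp [ha0]
  have hprod : ∀ e : {e : E // e ≠ b}, xt e * yt e = mu e := by
    intro e
    have hm : m e.1 = mu e := by simp [m, e.2]
    simp only [xt, yt, hip e.1 e.2, hm]
    have := hc0 (.inr e.1)
    field_simp
  have hZ : (xt, yt) ∈ Zl (InD L (fun e => lv (.inr e))) (InD L' (fun e => M - lv (ip e))) b mu :=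
    ⟨hxI, hyI, hxb, hyb, hprod⟩
  -- all levels are extreme
  have hext : ∀ e, lv (.inr e) = lv (.inl false) ∨ lv (.inr e) = lv (.inl true) := by
    intro e0
    by_contra hcon
    push Not at hcon
    obtain ⟨k1, k2⟩ := hcon
    have he0 : e0 ≠ b := by rintro rfl; exact k1 hlvb
    set k := lv (.inr e0) with hk
    have hkM : k ≤ M := hM _
    have hu := InD_level k hxI
    have hv := (InD L' _).neg_mem (InD_level (M - k) hyI)
    have hset : ∀ e, e ≠ b → ((M - lv (ip e) = M - k) ↔ lv (.inr e) = k) := by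
      intro e he
      rw [hip e he]
      have := hM (.inr e)
      omega
    have := (hInj _ _ _ hZ _ hu _ hv ?_ ?_ ?_).1
    · have := congrFun this e0
      simp [prj_apply, ← hk, xt] at this
      exact hc0 _ this
    · have : ¬ lv (.inr b) = k := by rw [hlvb]; exact fun h => k1 h.symm
      simp [prj_apply, this]
    · have : ¬ (M - lv (ip b) = M - k) := by
        rw [hipb]; have := hM (.inl true); omega
      simp only [Pi.neg_apply, prj_apply, Set.mem_ofPred_eq, if_neg this, neg_zero]
    · intro e
      simp only [Pi.neg_apply, prj_apply, Set.mem_ofPred_eq, hset e.1 e.2]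
      by_cases h : lv (.inr e.1) = k
      · simp only [h, if_true]; ring
      · simp only [h, if_false]; ring
  let A : Set E := {e | lv (.inr e) = lv (.inl true)}
  have hA1 : ∀ e, e ∈ A → lv (.inr e) = lv (.inl true) := fun e h => h
  have hA0 : ∀ e, e ∉ A → lv (.inr e) = lv (.inl false) := fun e h => (hext e).resolve_right h
  have hbA : b ∉ A := by
    intro h; have := hA1 b h; omega
  have hCe : ∀ e, e ∈ (insert b A)ᶜ ↔ e ≠ b ∧ e ∉ A := by intro e; simp
  have hC1 : ∀ e, e ∈ (insert b A)ᶜ → lv (ip e) = lv (.inl false) := by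
    intro e h
    rw [hCe] at h
    rw [hip e h.1]; exact hA0 e h.2
  have hC0 : ∀ e, e ∉ (insert b A)ᶜ → lv (ip e) = lv (.inl true) := by
    intro e h
    by_cases he : e = b
    · rw [he, hipb]
    · rw [hip e he]
      apply hA1; by_contra h'; exact h ((hCe e).2 ⟨he, h'⟩)
  have e1 := hM (.inl true)
  refine ⟨A, hbA, (xt, yt), ⟨?_, ?_, hxb, hyb, hprod⟩, fun e => hc0 _, ?_, ?_⟩
  · refine InD_congr (fun e e' h => ?_) (fun e e' h => ?_) hxI
    · unfold lvl at h
      split_ifs at h with g1 g2 g2 <;> try omega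
      rw [hA0 e g1, hA1 e' g2]; exact h1t
    · unfold lvl at h
      split_ifs at h with g1 g2 g2
      · rw [hA1 e g1, hA1 e' g2]
      · rw [hA0 e g1, hA0 e' g2]
  · refine InD_congr (fun e e' h => ?_) (fun e e' h => ?_) hyI
    · unfold lvl at h
      split_ifs at h with g1 g2 g2 <;> try omega
      rw [hC0 e g1, hC1 e' g2]; omega
    · unfold lvl at h
      split_ifs at h with g1 g2 g2
      · rw [hC1 e g1, hC1 e' g2]
      · rw [hC0 e g1, hC0 e' g2]
  · rw [tendsto_pi_nhds]
    intro e
    refine (hxt e).congr fun a => ?_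
    by_cases he : e ∈ A
    · rw [hA1 e he, hρt]; simp [dil, he, mul_comm]
    · rw [hA0 e he, hρ1]; simp [dil, he]
  · rw [tendsto_pi_nhds]
    intro e
    refine (hyt e).congr' ?_
    filter_upwards [hne] with a ha
    by_cases he : e ∈ (insert b A)ᶜ
    · simp only [ρ', hC1 e he, hρ1, dil, if_pos he]; field_simp
    · simp only [ρ', hC0 e he, hρt, dil, if_neg he]; field_simp



theorem ae_ne_zero {ι : Type} [Fintype ι] : ∀ᵐ mu : ι → ℂ, ∀ e, mu e ≠ 0 := by
  rw [ae_all_iff]; intro e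
  have := ae_poly (MvPolynomial.X e : MvPolynomial ι ℂ) (MvPolynomial.X_ne_zero e)
  simpa using this

theorem eventually_scale {ι : Type} [Fintype ι] (P : MvPolynomial ι ℂ) (mu : ι → ℂ)
    (h : MvPolynomial.eval mu P ≠ 0) :
    ∀ᶠ ε in 𝓝[≠] (0:ℂ), MvPolynomial.eval (ε⁻¹ • mu) P ≠ 0 := by
  let q : Polynomial ℂ := MvPolynomial.aeval (fun i => Polynomial.X * Polynomial.C (mu i)) P
  have hq : ∀ t : ℂ, q.eval t = MvPolynomial.eval (t • mu) P := by
    intro t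
    have : (Polynomial.aeval t).comp (MvPolynomial.aeval (fun i => Polynomial.X * Polynomial.C (mu i)))
        = MvPolynomial.aeval (R := ℂ) (t • mu) := by
      ext i; simp; ring
    have h2 := congrArg (fun f => f P) this
    simp only [AlgHom.comp_apply, MvPolynomial.aeval_eq_eval] at h2
    rw [← h2]
    simp [q, Polynomial.coe_aeval_eq_eval]
  have hq0 : q ≠ 0 := by
    intro h0
    apply h
    have := hq 1
    rw [h0] at this
    simpa using this.symm
  have hfin : {t : ℂ | q.eval t = 0}.Finite := Polynomial.finite_setOfPred_isRoot hq0
  have h1 : Tendsto (fun ε : ℂ => ε⁻¹) (𝓝[≠] 0) Filter.cofinite :=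
    Filter.tendsto_inv₀_nhdsNE_zero.mono_right (Bornology.le_cofinite ℂ)
  have h2 : ∀ᶠ t in Filter.cofinite, q.eval t ≠ 0 := hfin.eventually_cofinite_notMem
  filter_upwards [h1.eventually h2] with ε hε
  rw [← hq]; exact hε

abbrev XA {E : Type} (L L' : Submodule ℂ (E → ℂ)) (b : E) (A : Set E)
    (mu : {e : E // e ≠ b} → ℂ) : Set ((E → ℂ) × (E → ℂ)) :=
  Zl (InD L (lvl A)) (InD L' (lvl (insert b A)ᶜ)) b mu

theorem count_at {E : Type} [Fintype E] (L L' : Submodule ℂ (E → ℂ)) (b : E)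
    (hdim : Fintype.card E + 1 ≤ Module.finrank ℂ L + Module.finrank ℂ L')
    (P : MvPolynomial {e : E // e ≠ b} ℂ) (N : ℕ)
    (hP : ∀ lam, MvPolynomial.eval lam P ≠ 0 →
      (Zl L L' b lam).Finite ∧ Nat.card (Zl L L' b lam) = N)
    (mu : {e : E // e ≠ b} → ℂ) (hmu : ∀ e, mu e ≠ 0) (hPmu : MvPolynomial.eval mu P ≠ 0)
    (hInj : ∀ l l', InjAt (InD L l) (InD L' l') b mu) :
    Nat.card (Σ A : {A : Set E // b ∉ A}, XA L L' b A mu) = N ∧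
    Finite (Σ A : {A : Set E // b ∉ A}, XA L L' b A mu) := by
  have hev := eventually_scale P mu hPmu
  have hs : ∃ s : Fin N → ℂ → (E → ℂ) × (E → ℂ), ∀ᶠ ε in 𝓝[≠] (0:ℂ),
      (∀ i, s i ε ∈ Zl L L' b (ε⁻¹ • mu)) ∧ (∀ i j, s i ε = s j ε → i = j) ∧
      (∀ z ∈ Zl L L' b (ε⁻¹ • mu), ∃ i, s i ε = z) := by
    have : ∀ ε : ℂ, ∃ s : Fin N → (E → ℂ) × (E → ℂ), MvPolynomial.eval (ε⁻¹ • mu) P ≠ 0 → 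
      (∀ i, s i ∈ Zl L L' b (ε⁻¹ • mu)) ∧ (∀ i j, s i = s j → i = j) ∧
      (∀ z ∈ Zl L L' b (ε⁻¹ • mu), ∃ i, s i = z) := by
      intro ε
      by_cases h : MvPolynomial.eval (ε⁻¹ • mu) P ≠ 0
      · obtain ⟨h1, h2⟩ := hP _ h
        haveI := h1.to_subtype
        let f := (Finite.equivFinOfCardEq h2).symm
        refine ⟨fun i => (f i).1, fun _ => ⟨fun i => (f i).2, fun i j hij => ?_, fun z hz => ?_⟩⟩
        · exact f.injective (Subtype.ext hij)
        · exact ⟨f.symm ⟨z, hz⟩, by simp⟩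
      · exact ⟨fun _ => 0, fun h' => absurd h' h⟩
    choose s hs using this
    exact ⟨fun i ε => s ε i, hev.mono fun ε hε => hs ε hε⟩
  obtain ⟨s, hs⟩ := hs
  let U : Ultrafilter ℂ := Ultrafilter.of (𝓝[≠] (0:ℂ))
  have hU : (U : Filter ℂ) ≤ 𝓝[≠] 0 := Ultrafilter.of_le _
  have hsU := hU hs
  have hd : ∀ i, _ := fun i => dichotomy L L' b mu hmu hInj U hU (s i) (by
    filter_upwards [hsU] with ε hε using hε.1 i)
  choose A hA z hz hz0 ht1 ht2 using hd
  let Φ : Fin N → Σ A : {A : Set E // b ∉ A}, XA L L' b A mu :=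
    fun i => ⟨⟨A i, hA i⟩, ⟨z i, hz i⟩⟩
  have hinj : Function.Injective Φ := by
    intro i j hij
    have hAij : A i = A j := congrArg (fun q => q.1.1) hij
    have hzij : z i = z j := congrArg (fun q => q.2.1) hij
    obtain ⟨ξ, -, -, -, hξ⟩ := degen_ift L L' b hdim (A i) _ (hA i) rfl mu (hInj _ _) (z i) (hz i)
    have k1 := hξ U (s i) hU (by filter_upwards [hsU] with ε hε using hε.1 i) (ht1 i) (ht2 i)
    have k2 := hξ U (s j) hU (by filter_upwards [hsU] with ε hε using hε.1 j)
      (by rw [hAij, hzij]; exact ht1 j) (by rw [hAij, hzij]; exact ht2 j)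
    obtain ⟨ε, h1, h2, h3⟩ := (k1.and (k2.and hsU)).exists
    exact h3.2.1 i j (h1.trans h2.symm)
  have hsurj : Function.Surjective Φ := by
    rintro ⟨⟨A', hA'⟩, ⟨z', hz'⟩⟩
    obtain ⟨ξ, hξ1, hξ2, hξ3, -⟩ := degen_ift L L' b hdim A' _ hA' rfl mu (hInj _ _) z' hz'
    have hex : ∀ᶠ ε in (U : Filter ℂ), ∃ i, s i ε = ξ ε := by
      filter_upwards [hsU, hU hξ1] with ε h1 h2 using h1.2.2 _ h2
    have hi : ∃ i, ∀ᶠ ε in (U : Filter ℂ), s i ε = ξ ε := by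
      by_contra hcon
      push Not at hcon
      obtain ⟨ε, ⟨i, h1⟩, h2⟩ := (hex.and ((eventually_all).2 hcon)).exists
      exact h2 i h1
    obtain ⟨i, hi⟩ := hi
    have hx0 : ∀ e, z'.1 e ≠ 0 := by
      intro e he
      by_cases h : e = b
      · have := hz'.2.2.1; rw [← h, he] at this; exact zero_ne_one this
      · have := hz'.2.2.2.2 ⟨e, h⟩
        simp only [he, zero_mul] at this
        exact hmu _ this.symm
    have h1 : Tendsto (fun ε => dil A' ε (s i ε).1) U (𝓝 z'.1) :=
      (hξ2.mono_left hU).congr' (by filter_upwards [hi] with ε h using by rw [h])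
    have h2 : Tendsto (fun ε => dil (insert b A')ᶜ ε (s i ε).2) U (𝓝 z'.2) :=
      (hξ3.mono_left hU).congr' (by filter_upwards [hi] with ε h using by rw [h])
    have h0 : Tendsto (fun ε : ℂ => ε) U (𝓝 0) := hU.trans nhdsWithin_le_nhds
    have hcmp : ∀ (A A' : Set E) (z z' : E → ℂ), (∀ e, z' e ≠ 0) →
        Tendsto (fun ε => dil A ε (s i ε).1) U (𝓝 z) →
        Tendsto (fun ε => dil A' ε (s i ε).1) U (𝓝 z') → A' ⊆ A := by
      intro A A' z z' hz hA hA' e he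
      by_contra hne
      have t1 := tendsto_pi_nhds.1 hA e
      have t2 := tendsto_pi_nhds.1 hA' e
      simp only [dil, he, hne, if_true, if_false] at t1 t2
      have := tendsto_nhds_unique t2 (h0.mul t1)
      rw [zero_mul] at this
      exact hz e this
    have hAA : A i = A' := subset_antisymm (hcmp _ _ _ _ (hz0 i) h1 (ht1 i))
      (hcmp _ _ _ _ hx0 (ht1 i) h1)
    subst hAA
    have hzz : z i = z' := Prod.ext (tendsto_nhds_unique (ht1 i) h1)
      (tendsto_nhds_unique (ht2 i) h2)
    subst hzz
    exact ⟨i, rfl⟩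
  let e := Equiv.ofBijective Φ ⟨hinj, hsurj⟩
  exact ⟨by rw [← Nat.card_congr e]; simp, Finite.of_equiv _ e⟩

theorem count_ae {E : Type} [Fintype E] (L L' : Submodule ℂ (E → ℂ)) (b : E)
    (hdim : Module.finrank ℂ L + Module.finrank ℂ L' = Fintype.card E + 1)
    (P : MvPolynomial {e : E // e ≠ b} ℂ) (hP0 : P ≠ 0) (N : ℕ)
    (hP : ∀ lam, MvPolynomial.eval lam P ≠ 0 →
      (Zl L L' b lam).Finite ∧ Nat.card (Zl L L' b lam) = N) :
    ∀ᵐ mu : {e : E // e ≠ b} → ℂ,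
      ∑ A : {A : Set E // b ∉ A}, Nat.card (XA L L' b A mu) = N := by
  have h1 : ∀ᵐ mu : {e : E // e ≠ b} → ℂ, ∀ l l', InjAt (InD L l) (InD L' l') b mu := by
    rw [ae_all_iff]; intro l
    rw [ae_all_iff]; intro l'
    apply ae_InjAt
    have := finrank_InD_le L l
    have := finrank_InD_le L' l'
    omega
  filter_upwards [h1, ae_ne_zero, ae_poly P hP0] with mu h1 h2 h3
  obtain ⟨h4, h5⟩ := count_at L L' b hdim.ge P N hP mu h2 h3 h1
  haveI : ∀ A : {A : Set E // b ∉ A}, Finite (XA L L' b A mu) := fun A =>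
    Finite.of_injective (fun x => (⟨A, x⟩ : Σ A : {A : Set E // b ∉ A}, XA L L' b A mu))
      (fun x y h => eq_of_heq (Sigma.mk.inj h).2)
  rw [← h4, Nat.card_sigma]



theorem homog_poly {A : Type} (e' : A) (P : MvPolynomial {e : A // e ≠ e'} ℂ) :
    ∃ (k : ℕ) (Q : MvPolynomial A ℂ), ∀ mu : A → ℂ, mu e' ≠ 0 →
      MvPolynomial.eval mu Q = mu e' ^ k * MvPolynomial.eval (fun e : {e : A // e ≠ e'} => mu e / mu e') P := by
  induction P using MvPolynomial.induction_on with
  | C c => exact ⟨0, MvPolynomial.C c, fun mu _ => by simp⟩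
  | add p q hp hq =>
    obtain ⟨k, Q, h⟩ := hp
    obtain ⟨k', Q', h'⟩ := hq
    refine ⟨k + k', MvPolynomial.X e' ^ k' * Q + MvPolynomial.X e' ^ k * Q', fun mu h0 => ?_⟩
    simp only [map_add, map_mul, map_pow, MvPolynomial.eval_X, h mu h0, h' mu h0]
    ring
  | mul_X p i hp =>
    obtain ⟨k, Q, h⟩ := hp
    refine ⟨k + 1, Q * MvPolynomial.X i.1, fun mu h0 => ?_⟩
    simp only [map_mul, MvPolynomial.eval_X, h mu h0]
    field_simp
    ring

theorem ae_homog {A : Type} [Fintype A] (e' : A) (P : MvPolynomial {e : A // e ≠ e'} ℂ) (hP : P ≠ 0) :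
    ∀ᵐ mu : A → ℂ, MvPolynomial.eval (fun e : {e : A // e ≠ e'} => mu e / mu e') P ≠ 0 := by
  obtain ⟨k, Q, h⟩ := homog_poly e' P
  have hQ : Q ≠ 0 := by
    intro h0
    apply hP
    apply MvPolynomial.funext
    intro x
    have := h (fun e => if he : e = e' then 1 else x ⟨e, he⟩) (by simp)
    rw [h0] at this
    simp only [map_zero, dite_true, one_pow, one_mul, div_one] at this
    rw [map_zero]
    rw [show x = (fun e : {e : A // e ≠ e'} => (if he : e.1 = e' then 1 else x ⟨e, he⟩ : ℂ)) from ?_]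
    · exact this.symm
    · funext e; simp [e.2]
  filter_upwards [ae_poly Q hQ, ae_ne_zero] with mu h1 h2 h3
  apply h1
  rw [h mu (h2 e'), h3, mul_zero]

/-- solutions of a block -/
def BlkA {A : Type} (K : Submodule ℂ (A → ℂ)) (R : Submodule ℂ ((A → ℂ) × ℂ)) (mu : A → ℂ) :
    Set ((A → ℂ) × (A → ℂ)) :=
  {p | p.1 ∈ K ∧ (p.2, (1:ℂ)) ∈ R ∧ ∀ e, p.1 e * p.2 e = mu e}

theorem finrank_fst {A : Type} [Fintype A] (R : Submodule ℂ ((A → ℂ) × ℂ)) (h : ((0 : A → ℂ), (1:ℂ)) ∈ R) :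
    Module.finrank ℂ (R.map (LinearMap.fst ℂ (A → ℂ) ℂ)) + 1 ≤ Module.finrank ℂ R := by
  let f : R →ₗ[ℂ] (A → ℂ) := (LinearMap.fst ℂ (A → ℂ) ℂ).comp R.subtype
  have h1 := LinearMap.finrank_range_add_finrank_ker f
  have h2 : LinearMap.range f = R.map (LinearMap.fst ℂ (A → ℂ) ℂ) := by
    rw [LinearMap.range_comp, Submodule.range_subtype]
  have h3 : 0 < Module.finrank ℂ (LinearMap.ker f) := by
    have : Nontrivial (LinearMap.ker f) := by
     refine ⟨⟨⟨⟨_, h⟩, by simp [f]⟩, 0, fun hh => ?_⟩⟩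
     have := congrArg (fun q => q.1.1.2) hh
     simp at this
    exact Module.finrank_pos (R := ℂ) (M := LinearMap.ker f)
  rw [h2] at h1
  omega

theorem finrank_R0 {A : Type} [Fintype A] (R : Submodule ℂ ((A → ℂ) × ℂ)) (h : ∃ r ∈ R, r.2 ≠ 0) :
    Module.finrank ℂ (R.comap (LinearMap.inl ℂ (A → ℂ) ℂ)) + 1 ≤ Module.finrank ℂ R := by
  let g : (R.comap (LinearMap.inl ℂ (A → ℂ) ℂ)) →ₗ[ℂ] ((A → ℂ) × ℂ) :=
    (LinearMap.inl ℂ (A → ℂ) ℂ).comp (Submodule.subtype _)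
  let R1 := LinearMap.range g
  have hg : Function.Injective g := by
    intro x y hxy
    exact Subtype.ext (congrArg Prod.fst hxy)
  have h1 : Module.finrank ℂ R1 = Module.finrank ℂ (R.comap (LinearMap.inl ℂ (A → ℂ) ℂ)) :=
    LinearMap.finrank_range_of_inj hg
  have h2 : R1 < R := by
    refine lt_of_le_of_ne ?_ ?_
    · rintro _ ⟨x, rfl⟩; exact x.2
    · intro heq
      obtain ⟨r, hr, hr0⟩ := h
      rw [← heq] at hr
      obtain ⟨x, rfl⟩ := hr
      exact hr0 rfl
  have := Submodule.finrank_lt_finrank_of_lt h2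
  omega

theorem lemC {A : Type} [Fintype A] (K : Submodule ℂ (A → ℂ)) (R : Submodule ℂ ((A → ℂ) × ℂ))
    (e' : A) (hdim : Module.finrank ℂ K + Module.finrank ℂ R ≤ Fintype.card A + 1)
    (hR : ∃ r ∈ R, r.2 ≠ 0) (P : MvPolynomial {e : A // e ≠ e'} ℂ) (hP0 : P ≠ 0) (N : ℕ)
    (hP : ∀ lam, MvPolynomial.eval lam P ≠ 0 →
      Nat.card (Zl K (R.map (LinearMap.fst ℂ (A → ℂ) ℂ)) e' lam) = N) :
    ∀ᵐ mu : A → ℂ, Nat.card (BlkA K R mu) = N := by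
  have : Nonempty A := ⟨e'⟩
  set RA := R.map (LinearMap.fst ℂ (A → ℂ) ℂ) with hRA
  have memRA : ∀ c, c ∈ RA ↔ ∃ s, (c, s) ∈ R := by
    intro c; simp [hRA, Submodule.mem_map]
  -- scaling up a normalised solution
  have up : ∀ mu : A → ℂ, mu e' ≠ 0 → ∀ z ∈ Zl K RA e' (fun e : {e : A // e ≠ e'} => mu e / mu e'),
      ∀ e, (mu e' • z.1) e * z.2 e = mu e := by
    intro mu h0 z hz e
    obtain ⟨h1, h2, h3, h4, h5⟩ := hz
    by_cases he : e = e'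
    · subst he; simp [h3, h4]
    · have := h5 ⟨e, he⟩
      simp only at this
      simp only [Pi.smul_apply, smul_eq_mul, mul_assoc, this]
      field_simp
  by_cases h01 : ((0 : A → ℂ), (1:ℂ)) ∈ R
  · have hd := finrank_fst R h01
    filter_upwards [ae_no_sol K RA (by rw [hRA]; omega), ae_homog e' P hP0, ae_ne_zero] with mu h1 h2 h3
    rw [← hP _ h2]
    have e1 : BlkA K R mu = ∅ := by
      ext p
      simp only [Set.mem_empty_iff_false, iff_false]
      rintro ⟨g1, g2, g3⟩
      exact h1 _ g1 _ ((memRA _).2 ⟨1, g2⟩) g3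
    have e2 : Zl K RA e' (fun e : {e : A // e ≠ e'} => mu e / mu e') = ∅ := by
      ext p
      simp only [Set.mem_empty_iff_false, iff_false]
      intro hp
      exact h1 _ (K.smul_mem _ hp.1) _ hp.2.1 (up mu (h3 e') p hp)
    rw [e1, e2]
  · have hd := finrank_R0 R hR
    filter_upwards [ae_no_sol K (R.comap (LinearMap.inl ℂ (A → ℂ) ℂ)) (by omega), ae_homog e' P hP0, ae_ne_zero] with mu h1 h2 h3
    rw [← hP _ h2]
    have hne : ∀ p ∈ BlkA K R mu, ∀ e, p.1 e ≠ 0 ∧ p.2 e ≠ 0 := by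
      rintro p ⟨g1, g2, g3⟩ e
      have := g3 e
      constructor <;> intro h <;> simp [h] at this <;> exact h3 e this.symm
    let f : BlkA K R mu → Zl K RA e' (fun e : {e : A // e ≠ e'} => mu e / mu e') := fun p =>
      ⟨((p.1.1 e')⁻¹ • p.1.1, (p.1.2 e')⁻¹ • p.1.2), by
        obtain ⟨n1, n2⟩ := hne p.1 p.2 e'
        obtain ⟨g1, g2, g3⟩ := p.2
        refine ⟨K.smul_mem _ g1, RA.smul_mem _ ((memRA _).2 ⟨1, g2⟩), by simp [n1], by simp [n2],
          fun e => ?_⟩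
        simp only [Pi.smul_apply, smul_eq_mul]
        rw [← g3 e, ← g3 e']
        field_simp⟩
    refine Nat.card_congr (Equiv.ofBijective f ⟨?_, ?_⟩)
    · rintro ⟨⟨a, c⟩, hp⟩ ⟨⟨a2, c2⟩, hp2⟩ hf
      have hf2 : (c e')⁻¹ • c = (c2 e')⁻¹ • c2 := congrArg (fun q => q.1.2) hf
      have n1 := hne _ hp
      have n2 := hne _ hp2
      simp only at n1 n2
      obtain ⟨g1, g2, g3⟩ := hp
      obtain ⟨k1, k2, k3⟩ := hp2
      simp only at g1 g2 g3 k1 k2 k3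
      have hr : c2 = (c2 e' / c e') • c := by
        rw [div_eq_mul_inv, mul_smul, hf2, smul_smul, mul_inv_cancel₀ (n2 e').2, one_smul]
      set r := c2 e' / c e' with hrdef
      have hr1 : r = 1 := by
        by_contra hr1
        apply h01
        have h5 := R.sub_mem (R.smul_mem r g2) k2
        have h6 := R.smul_mem (r - 1)⁻¹ h5
        have : (r - 1) ≠ 0 := sub_ne_zero.2 hr1
        simpa [hr, this] using h6
      have hc : c2 = c := by rw [hr, hr1, one_smul]
      subst hc
      have ha : a = a2 := by
        funext e
        exact mul_right_cancel₀ (n1 e).2 ((g3 e).trans (k3 e).symm)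
      subst ha
      rfl
    · rintro ⟨⟨a, c⟩, hz⟩
      have hup := up mu (h3 e') _ hz
      obtain ⟨g1, g2, g3, g4, g5⟩ := id hz
      obtain ⟨s, hs⟩ := (memRA _).1 g2
      simp only at g1 g2 g3 g4 g5 hup hs
      have hs0 : s ≠ 0 := by
        rintro rfl
        exact h1 _ (K.smul_mem (mu e') g1) c hs hup
      refine ⟨⟨((s * mu e') • a, s⁻¹ • c), K.smul_mem _ g1, ?_, fun e => ?_⟩, ?_⟩
      · have := R.smul_mem s⁻¹ hs
        simpa [hs0] using this
      · have := hup e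
        simp only [Pi.smul_apply, smul_eq_mul] at this ⊢
        rw [← this]; field_simp
      · apply Subtype.ext
        simp only [f]
        have := h3 e'
        refine Prod.ext ?_ ?_
        · funext e; simp [g3]; field_simp
        · funext e; simp [g4]; field_simp



def ext0 {E : Type} (S : Set E) : (S → ℂ) →ₗ[ℂ] (E → ℂ) where
  toFun a e := if h : e ∈ S then a ⟨e, h⟩ else 0
  map_add' x y := by ext e; by_cases h : e ∈ S <;> simp [h]
  map_smul' c x := by ext e; by_cases h : e ∈ S <;> simp [h]

theorem ext0_apply {E : Type} (S : Set E) (a : S → ℂ) (e : E) :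
    ext0 S a e = if h : e ∈ S then a ⟨e, h⟩ else 0 := rfl

def res {E : Type} (S : Set E) : (E → ℂ) →ₗ[ℂ] (S → ℂ) := LinearMap.funLeft ℂ ℂ Subtype.val

theorem res_apply {E : Type} (S : Set E) (x : E → ℂ) (e : S) : res S x e = x e := rfl

def KK {E : Type} (L : Submodule ℂ (E → ℂ)) (S : Set E) : Submodule ℂ (S → ℂ) := L.comap (ext0 S)

def RR {E : Type} (L : Submodule ℂ (E → ℂ)) (S : Set E) (b : E) : Submodule ℂ ((S → ℂ) × ℂ) :=
  L.map ((res S).prod (LinearMap.proj b))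

theorem RR_fst {E : Type} (L : Submodule ℂ (E → ℂ)) (S : Set E) (b : E) :
    (RR L S b).map (LinearMap.fst ℂ (S → ℂ) ℂ) = L.map (res S) := by
  rw [RR, ← Submodule.map_comp, LinearMap.fst_prod]

theorem mem_RR {E : Type} {L : Submodule ℂ (E → ℂ)} {S : Set E} {b : E} {c : S → ℂ} {s : ℂ} :
    (c, s) ∈ RR L S b ↔ ∃ w ∈ L, (∀ e : S, w e = c e) ∧ w b = s := by
  constructor
  · rintro ⟨w, hw, h⟩
    refine ⟨w, hw, fun e => congrFun (congrArg Prod.fst h) e, congrArg Prod.snd h⟩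
  · rintro ⟨w, hw, h1, h2⟩
    exact ⟨w, hw, Prod.ext (funext h1) h2⟩

theorem finrank_split {E : Type} [Fintype E] (L : Submodule ℂ (E → ℂ)) (A C : Set E) (b : E)
    (h : ∀ e, e ∈ A ↔ e ≠ b ∧ e ∉ C) :
    Module.finrank ℂ (KK L A) + Module.finrank ℂ (RR L C b) = Module.finrank ℂ L := by
  let f : L →ₗ[ℂ] ((C → ℂ) × ℂ) := ((res C).prod (LinearMap.proj b)).comp L.subtype
  have h1 := LinearMap.finrank_range_add_finrank_ker f
  have h2 : LinearMap.range f = RR L C b := by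
    rw [LinearMap.range_comp, Submodule.range_subtype]; rfl
  have hx : ∀ x : E → ℂ, ((res C).prod (LinearMap.proj b)) x = 0 → ext0 A (res A x) = x := by
    intro x hx
    funext e
    rw [ext0_apply]
    split_ifs with he
    · rfl
    · rw [h] at he
      by_cases heb : e = b
      · rw [heb]; exact (congrArg Prod.snd hx).symm
      · have : e ∈ C := by by_contra h'; exact he ⟨heb, h'⟩
        exact (congrFun (congrArg Prod.fst hx) ⟨e, this⟩).symm
  let g : LinearMap.ker f ≃ₗ[ℂ] KK L A :=
    { toFun := fun x => ⟨res A x.1.1, by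
        change ext0 A _ ∈ L
        rw [hx x.1.1 x.2]; exact x.1.2⟩
      map_add' := fun _ _ => rfl
      map_smul' := fun _ _ => rfl
      invFun := fun a => ⟨⟨ext0 A a.1, a.2⟩, by
        rw [LinearMap.mem_ker]
        refine Prod.ext (funext fun e => ?_) ?_
        · change ext0 A a.1 e = 0
          have : e.1 ∉ A := by rw [h]; exact fun h => h.2 e.2
          rw [ext0_apply, dif_neg this]
        · change ext0 A a.1 b = 0
          have : b ∉ A := by rw [h]; exact fun h => h.1 rfl
          rw [ext0_apply, dif_neg this]⟩
      left_inv := fun x => Subtype.ext (Subtype.ext (hx x.1.1 x.2))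
      right_inv := fun a => Subtype.ext (funext fun e => by
        change ext0 A a.1 e = _
        rw [ext0_apply, dif_pos e.2]) }
  rw [← g.finrank_eq, ← h2]
  omega

theorem card_XA {E : Type} [Fintype E] (L L' : Submodule ℂ (E → ℂ)) (A : Set E) (b : E)
    (hbA : b ∉ A) (mu : {e : E // e ≠ b} → ℂ) :
    Nat.card (XA L L' b A mu) =
      Nat.card (BlkA (KK L A) (RR L' A b) (fun e : A => mu ⟨e, fun h => hbA (h ▸ e.2)⟩)) *
      Nat.card (BlkA (KK L' (insert b A)ᶜ) (RR L (insert b A)ᶜ b)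
        (fun e : ((insert b A)ᶜ : Set E) => mu ⟨e, fun h => e.2 (Or.inl h)⟩)) := by
  set C := (insert b A)ᶜ with hC
  have hCe : ∀ e, e ∈ C ↔ e ≠ b ∧ e ∉ A := by intro e; simp [hC]
  rw [show XA L L' b A mu = Zl (InD L (lvl A)) (InD L' (lvl C)) b mu from rfl]
  have hCb : ∀ e : C, e.1 ≠ b := fun e => ((hCe _).1 e.2).1
  change _ = _ * Nat.card (BlkA (KK L' C) (RR L C b) (fun e : C => mu ⟨e, hCb e⟩))
  clear_value C
  have hbC : b ∉ C := by rw [hCe]; simp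
  rw [← Nat.card_prod]
  have hprj : ∀ (S : Set E) (x : E → ℂ), ext0 S (res S x) = prj S x := by
    intro S x; ext e; rw [ext0_apply, prj_apply]; split_ifs <;> rfl
  refine Nat.card_congr
    { toFun := fun z => (⟨(res A z.1.1, res A z.1.2), ?_⟩, ⟨(res C z.1.2, res C z.1.1), ?_⟩)
      invFun := fun q => ⟨(fun e => if h : e ∈ A then q.1.1.1 ⟨e, h⟩ else
          if h : e ∈ C then q.2.1.2 ⟨e, h⟩ else 1,
        fun e => if h : e ∈ A then q.1.1.2 ⟨e, h⟩ else
          if h : e ∈ C then q.2.1.1 ⟨e, h⟩ else 1), ?_⟩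
      left_inv := ?_
      right_inv := ?_ }
  · obtain ⟨h1, h2, h3, h4, h5⟩ := z.2
    rw [mem_InD_lvl] at h1 h2
    refine ⟨?_, ?_, fun e => h5 ⟨e.1, _⟩⟩
    · change ext0 A (res A _) ∈ L
      rw [hprj]; exact h1.1
    · obtain ⟨w, hw, hwx⟩ := h2.2
      rw [mem_RR]
      exact ⟨w, hw, fun e => hwx e (fun h => ((hCe _).1 h).2 e.2), by rw [hwx b hbC, h4]⟩
  · obtain ⟨h1, h2, h3, h4, h5⟩ := z.2
    rw [mem_InD_lvl] at h1 h2
    refine ⟨?_, ?_, fun e => ?_⟩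
    · change ext0 C (res C _) ∈ L'
      rw [hprj]; exact h2.1
    · obtain ⟨w, hw, hwx⟩ := h1.2
      rw [mem_RR]
      exact ⟨w, hw, fun e => hwx e (((hCe _).1 e.2).2), by rw [hwx b hbA, h3]⟩
    · rw [mul_comm]; exact h5 ⟨e.1, _⟩
  · obtain ⟨⟨p1, hp1⟩, ⟨p2, hp2⟩⟩ := q
    obtain ⟨a1, a2, a3⟩ := hp1
    obtain ⟨c1, c2, c3⟩ := hp2
    rw [mem_RR] at a2 c2
    obtain ⟨w, hw, hw1, hw2⟩ := a2
    obtain ⟨u, hu, hu1, hu2⟩ := c2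
    refine ⟨?_, ?_, ?_, ?_, ?_⟩
    · rw [mem_InD_lvl]
      refine ⟨?_, u, hu, fun e he => ?_⟩
      · convert (show ext0 A p1.1 ∈ L from a1) using 1
        ext e
        rw [ext0_apply, prj_apply]
        by_cases he : e ∈ A <;> simp [he]
      · have he : e ∉ A := he
        by_cases heC : e ∈ C
        · simp only [he, heC, dite_true, dite_false]; exact hu1 ⟨e, heC⟩
        · have : e = b := by by_contra h; exact heC ((hCe e).2 ⟨h, he⟩)
          simp only [he, heC, dite_false, this, hu2]
          simp [hbA, hbC]
    · rw [mem_InD_lvl]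
      refine ⟨?_, w, hw, fun e heC => ?_⟩
      · convert (show ext0 C p2.1 ∈ L' from c1) using 1
        ext e
        rw [ext0_apply, prj_apply]
        by_cases he : e ∈ C
        · have := ((hCe e).1 he).2
          simp only [he, this, dite_true, dite_false, if_true]
        · simp only [he, dite_false, if_false]
      · have heC : e ∉ C := heC
        by_cases he : e ∈ A
        · simp only [he, dite_true]; exact hw1 ⟨e, he⟩
        · have : e = b := by by_contra h; exact heC ((hCe e).2 ⟨h, he⟩)
          simp only [he, heC, dite_false, this, hw2]
          simp [hbA, hbC]
    · simp [hbA, hbC]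
    · simp [hbA, hbC]
    · intro e
      by_cases he : e.1 ∈ A
      · simp only [he, dite_true]; exact a3 ⟨e.1, he⟩
      · have heC : e.1 ∈ C := (hCe _).2 ⟨e.2, he⟩
        simp only [he, heC, dite_true, dite_false]
        rw [mul_comm]; exact c3 ⟨e.1, heC⟩
  · rintro ⟨⟨x, y⟩, hz⟩
    have hxb : x b = 1 := hz.2.2.1
    have hyb : y b = 1 := hz.2.2.2.1
    apply Subtype.ext
    refine Prod.ext (funext fun e => ?_) (funext fun e => ?_)
    · simp only [res_apply]
      split_ifs with h1 h2
      · rfl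
      · rfl
      · have : e = b := by by_contra h; exact h2 ((hCe e).2 ⟨h, h1⟩)
        rw [this, hxb]
    · simp only [res_apply]
      split_ifs with h1 h2
      · rfl
      · rfl
      · have : e = b := by by_contra h; exact h2 ((hCe e).2 ⟨h, h1⟩)
        rw [this, hyb]
  · rintro ⟨⟨⟨a, c⟩, hp1⟩, ⟨⟨a', c'⟩, hp2⟩⟩
    refine Prod.ext (Subtype.ext (Prod.ext ?_ ?_)) (Subtype.ext (Prod.ext ?_ ?_))
    · funext e; simp [res_apply]
    · funext e; simp [res_apply]
    · funext e; simp [res_apply, ((hCe _).1 e.2).2]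
    · funext e; simp [res_apply, ((hCe _).1 e.2).2]

/-- The Laman-number hypothesis on a block. -/
def BH {A : Type} (K RA : Submodule ℂ (A → ℂ)) (N : ℕ) : Prop :=
  (N = 0 ∧ ((∃ e, ∀ a ∈ K, a e = 0) ∨ (∃ e, ∀ c ∈ RA, c e = 0))) ∨
  ∃ (K' : Submodule ℂ (A → ℂ)) (s : A → ℂ) (e' : A) (P : MvPolynomial {e : A // e ≠ e'} ℂ),
    (∀ e, s e ≠ 0) ∧ (∀ a, a ∈ K ↔ s * a ∈ K') ∧ P ≠ 0 ∧
    ∀ lam, MvPolynomial.eval lam P ≠ 0 → Nat.card (Zl K' RA e' lam) = N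

theorem lemC' {A : Type} [Fintype A] (K : Submodule ℂ (A → ℂ)) (R : Submodule ℂ ((A → ℂ) × ℂ))
    (hdim : Module.finrank ℂ K + Module.finrank ℂ R ≤ Fintype.card A + 1)
    (hR : ∃ r ∈ R, r.2 ≠ 0) (N : ℕ) (h : BH K (R.map (LinearMap.fst ℂ (A → ℂ) ℂ)) N) :
    ∀ᵐ mu : A → ℂ, Nat.card (BlkA K R mu) = N := by
  rcases h with ⟨rfl, h⟩ | ⟨K', s, e', P, hs, hK, hP0, hP⟩
  · filter_upwards [ae_ne_zero] with mu hmu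
    have : BlkA K R mu = ∅ := by
      ext p
      simp only [Set.mem_empty_iff_false, iff_false]
      rintro ⟨g1, g2, g3⟩
      rcases h with ⟨e, he⟩ | ⟨e, he⟩
      · have := g3 e; rw [he _ g1, zero_mul] at this; exact hmu e this.symm
      · have := g3 e; rw [he p.2 ⟨_, g2, rfl⟩, mul_zero] at this; exact hmu e this.symm
    rw [this]; simp
  · let D : (A → ℂ) →ₗ[ℂ] (A → ℂ) := LinearMap.mulLeft ℂ s
    have hD : ∀ a, D a = s * a := fun _ => rfl
    have hDs : ∀ a, s * (s⁻¹ * a) = a := by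
      intro a; funext e; simp [hs e]
    have hK' : K' ≤ K.map D := by
      intro a ha
      refine ⟨s⁻¹ * a, ?_, ?_⟩
      · change _ ∈ K
        rw [hK, hDs]; exact ha
      · rw [hD, hDs]
    have hfr : Module.finrank ℂ K' ≤ Module.finrank ℂ K :=
      (Submodule.finrank_mono hK').trans (Submodule.finrank_map_le D K)
    have h1 := lemC K' R e' (by omega) hR P hP0 N hP
    have h2 := ae_comp_surj D (fun a => ⟨s⁻¹ * a, by rw [hD, hDs]⟩) h1
    filter_upwards [h2] with mu hmu
    rw [← hmu]
    refine Nat.card_congr (Equiv.ofBijective (fun p => ⟨(s * p.1.1, p.1.2), ?_⟩) ⟨?_, ?_⟩)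
    · obtain ⟨g1, g2, g3⟩ := p.2
      refine ⟨(hK _).1 g1, g2, fun e => ?_⟩
      rw [hD]; simp only [Pi.mul_apply, mul_assoc, g3 e]
    · rintro ⟨⟨a, c⟩, hp⟩ ⟨⟨a2, c2⟩, hp2⟩ h
      have h1 : s * a = s * a2 := congrArg (fun q => q.1.1) h
      have h2 : c = c2 := congrArg (fun q => q.1.2) h
      have h3 : a = a2 := funext fun e => mul_left_cancel₀ (hs e) (congrFun h1 e)
      subst h2 h3; rfl
    · rintro ⟨⟨a, c⟩, g1, g2, g3⟩
      refine ⟨⟨(s⁻¹ * a, c), (hK _).2 (by rw [hDs]; exact g1), g2, fun e => ?_⟩, ?_⟩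
      · have := g3 e
        rw [hD] at this
        simp only [Pi.mul_apply, Pi.inv_apply] at this ⊢
        have h0 := hs e
        field_simp; linear_combination this
      · apply Subtype.ext
        simp only [hDs]



theorem ae_res {E : Type} [Fintype E] (b : E) (S : Set E) [Fintype S] (hb : ∀ e : S, e.1 ≠ b)
    {p : (S → ℂ) → Prop} (h : ∀ᵐ y : S → ℂ, p y) :
    ∀ᵐ mu : {e : E // e ≠ b} → ℂ, p (fun e => mu ⟨e, hb e⟩) := by
  refine ae_comp_surj (LinearMap.funLeft ℂ ℂ (fun e : S => (⟨e, hb e⟩ : {e : E // e ≠ b}))) ?_ h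
  apply LinearMap.funLeft_surjective_of_injective
  intro x y hxy
  exact Subtype.ext (congrArg (fun z => z.1) hxy)

theorem finrank_res_le {E : Type} [Fintype E] (L : Submodule ℂ (E → ℂ)) (S : Set E) (b : E) :
    Module.finrank ℂ (L.map (res S)) ≤ Module.finrank ℂ (RR L S b) := by
  rw [← RR_fst L S b]
  exact Submodule.finrank_map_le _ _

theorem card_split {E : Type} [Fintype E] (A : Set E) (b : E) (hb : b ∉ A) :
    Nat.card A + Nat.card ((insert b A)ᶜ : Set E) + 1 = Fintype.card E := by
  rw [Nat.card_eq_fintype_card, Nat.card_eq_fintype_card]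
  have h1 := Fintype.card_compl_set (insert b A)
  have h2 : Fintype.card (insert b A : Set E) = Fintype.card A + 1 := by
    rw [← Nat.card_eq_fintype_card, ← Nat.card_eq_fintype_card, Nat.card_coe_set_eq,
      Nat.card_coe_set_eq, Set.ncard_insert_of_notMem hb]
  have h3 := set_fintype_card_le_univ (insert b A : Set E)
  omega

/-- one block has no solutions if its dimension is too small -/
theorem blk_zero {A : Type} [Fintype A] [Nonempty A] (K : Submodule ℂ (A → ℂ))
    (R : Submodule ℂ ((A → ℂ) × ℂ))
    (hdim : Module.finrank ℂ K + Module.finrank ℂ (R.map (LinearMap.fst ℂ (A → ℂ) ℂ))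
      ≤ Fintype.card A) :
    ∀ᵐ mu : A → ℂ, Nat.card (BlkA K R mu) = 0 := by
  filter_upwards [ae_no_sol K _ hdim] with mu hmu
  have : BlkA K R mu = ∅ := by
    ext p
    simp only [Set.mem_empty_iff_false, iff_false]
    rintro ⟨g1, g2, g3⟩
    exact hmu _ g1 p.2 ⟨_, g2, rfl⟩ g3
  rw [this]; simp

theorem blk_one {A : Type} [IsEmpty A] (K : Submodule ℂ (A → ℂ))
    (R : Submodule ℂ ((A → ℂ) × ℂ)) (hR : ∃ r ∈ R, r.2 ≠ 0) (mu : A → ℂ) :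
    Nat.card (BlkA K R mu) = 1 := by
  rw [Nat.card_eq_one_iff_unique]
  obtain ⟨r, hr, hr2⟩ := hR
  refine ⟨⟨fun x y => Subsingleton.elim _ _⟩, ⟨⟨(0, 0), K.zero_mem, ?_, fun e => isEmptyElim e⟩⟩⟩
  have := R.smul_mem (r.2)⁻¹ hr
  convert this using 1
  refine Prod.ext (Subsingleton.elim _ _) ?_
  simp [hr2]

theorem RR_ne {E : Type} (L : Submodule ℂ (E → ℂ)) (S : Set E) (b : E) (h : ∃ x ∈ L, x b ≠ 0) :
    ∃ r ∈ RR L S b, r.2 ≠ 0 := by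
  obtain ⟨x, hx, h⟩ := h
  exact ⟨_, ⟨x, hx, rfl⟩, h⟩

def GoodA {E : Type} [Fintype E] (L L' : Submodule ℂ (E → ℂ)) (b : E) (A : Set E) : Prop :=
  A.Nonempty ∧ ((insert b A)ᶜ : Set E).Nonempty ∧
  Module.finrank ℂ (KK L A) + Module.finrank ℂ (L'.map (res A)) = Nat.card A + 1 ∧
  Module.finrank ℂ (KK L' (insert b A)ᶜ) + Module.finrank ℂ (L.map (res (insert b A)ᶜ)) =
    Nat.card ((insert b A)ᶜ : Set E) + 1

theorem finrank_RR_pos {E : Type} [Fintype E] (L : Submodule ℂ (E → ℂ)) (S : Set E) (b : E)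
    (h : ∃ x ∈ L, x b ≠ 0) : 1 ≤ Module.finrank ℂ (RR L S b) := by
  obtain ⟨r, hr, h⟩ := RR_ne L S b h
  rw [Nat.one_le_iff_ne_zero]
  intro h0
  have := Submodule.finrank_eq_zero.1 h0
  rw [this] at hr
  rw [(Submodule.mem_bot ℂ).1 hr] at h
  exact h rfl

theorem main_linear {E : Type} [Fintype E] (L L' : Submodule ℂ (E → ℂ)) (b : E)
    (hdim : Module.finrank ℂ L + Module.finrank ℂ L' = Fintype.card E + 1)
    (hb : ∃ x ∈ L, x b ≠ 0) (hb' : ∃ x ∈ L', x b ≠ 0) (hE : 2 ≤ Fintype.card E)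
    (P : MvPolynomial {e : E // e ≠ b} ℂ) (hP0 : P ≠ 0) (N N₁ N₂ : ℕ)
    (hP : ∀ lam, MvPolynomial.eval lam P ≠ 0 →
      (Zl L L' b lam).Finite ∧ Nat.card (Zl L L' b lam) = N)
    (h1 : BH (KK L {b}ᶜ) (L'.map (res {b}ᶜ)) N₁)
    (h2 : BH (KK L' {b}ᶜ) (L.map (res {b}ᶜ)) N₂)
    (F F' : Set E → ℕ)
    (hF : ∀ A, b ∉ A → GoodA L L' b A → BH (KK L A) (L'.map (res A)) (F A))
    (hF' : ∀ A, b ∉ A → GoodA L L' b A →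
      BH (KK L' (insert b A)ᶜ) (L.map (res (insert b A)ᶜ)) (F' A)) :
    N = N₁ + N₂ + ∑ A : {A : Set E // b ∉ A}, if GoodA L L' b A then F A * F' A else 0 := by
  have key : ∀ A : {A : Set E // b ∉ A}, ∀ᵐ mu : {e : E // e ≠ b} → ℂ,
      Nat.card (XA L L' b A mu) =
        (if A.1 = {b}ᶜ then N₁ else 0) + (if A.1 = ∅ then N₂ else 0) +
        (if GoodA L L' b A then F A * F' A else 0) := by
    rintro ⟨A, hbA⟩
    dsimp only
    have hAb : ∀ e : A, e.1 ≠ b := fun e h => hbA (h ▸ e.2)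
    set C := (insert b A)ᶜ with hC
    have hCe : ∀ e, e ∈ C ↔ e ≠ b ∧ e ∉ A := by intro e; simp [hC]
    have hCb : ∀ e : C, e.1 ≠ b := fun e => ((hCe _).1 e.2).1
    have hAe : ∀ e, e ∈ A ↔ e ≠ b ∧ e ∉ C := by
      intro e
      constructor
      · intro h; exact ⟨hAb ⟨e, h⟩, fun h' => ((hCe e).1 h').2 h⟩
      · rintro ⟨h, h'⟩; by_contra h2; exact h' ((hCe e).2 ⟨h, h2⟩)
    have hcard := card_split A b hbA
    have hd1 := finrank_split L A C b hAe
    have hd2 := finrank_split L' C A b hCe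
    have hr1 := finrank_res_le L C b
    have hr2 := finrank_res_le L' A b
    have hp1 := finrank_RR_pos L C b hb
    have hp2 := finrank_RR_pos L' A b hb'
    rw [← hC] at hcard
    have hcA : Nat.card A = Fintype.card A := Nat.card_eq_fintype_card
    have hcC : Nat.card C = Fintype.card C := Nat.card_eq_fintype_card
    have cx := fun mu => card_XA L L' A b hbA mu
    -- generic combination
    have comb : ∀ n m : ℕ, (∀ᵐ mu : A → ℂ, Nat.card (BlkA (KK L A) (RR L' A b) mu) = n) →
        (∀ᵐ mu : C → ℂ, Nat.card (BlkA (KK L' C) (RR L C b) mu) = m) →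
        ∀ᵐ mu : {e : E // e ≠ b} → ℂ, Nat.card (XA L L' b A mu) = n * m := by
      intro n m hn hm
      filter_upwards [ae_res b A hAb hn, ae_res b C hCb hm] with mu g1 g2
      rw [cx mu, g1]
      congr 1
    by_cases hA0 : A = ∅
    · have hCeq : C = {b}ᶜ := by rw [hC, hA0]; simp
      have hne : ¬ A = {b}ᶜ := by
        intro h
        have : Fintype.card E ≤ 1 := by
          have h3 : Fintype.card A = 0 := by subst hA0; simp
          have h4 : C = ∅ := by rw [hC, h]; ext e; simp
          have h5 : Fintype.card C = 0 := by rw [Fintype.card_eq_zero_iff, h4]; infer_instance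
          omega
        omega
      have hng : ¬ GoodA L L' b A := fun h => by rw [hA0] at h; exact Set.not_nonempty_empty h.1
      rw [if_neg hne, if_pos hA0, if_neg hng]
      have : IsEmpty A := by rw [hA0]; infer_instance
      have hA0c : Fintype.card A = 0 := Fintype.card_eq_zero
      have := comb 1 N₂ (Eventually.of_forall fun mu => blk_one _ _ (RR_ne L' A b hb') mu)
        (lemC' _ _ (by omega) (RR_ne L C b hb) N₂ (by rw [RR_fst, hCeq]; exact h2))
      simpa using this
    by_cases hC0 : C = ∅
    · have hAeq : A = {b}ᶜ := by
        ext e; rw [hAe, hC0]; simp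
      have hng : ¬ GoodA L L' b A := fun h => by
        have := h.2.1; rw [← hC, hC0] at this; exact Set.not_nonempty_empty this
      rw [if_pos hAeq, if_neg hA0, if_neg hng]
      have : IsEmpty C := by rw [hC0]; infer_instance
      have hC0c : Fintype.card C = 0 := Fintype.card_eq_zero
      have := comb N₁ 1
        (lemC' _ _ (by omega) (RR_ne L' A b hb') N₁ (by rw [RR_fst]; subst hAeq; exact h1))
        (Eventually.of_forall fun mu => blk_one _ _ (RR_ne L C b hb) mu)
      simpa using this
    have hne : ¬ A = {b}ᶜ := by
      intro h; apply hC0; rw [hC, h]; ext e; simp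
    rw [if_neg hne, if_neg hA0]
    have hAn := Set.nonempty_iff_ne_empty.2 hA0
    have hCn := Set.nonempty_iff_ne_empty.2 hC0
    have : Nonempty A := hAn.to_subtype
    have : Nonempty C := hCn.to_subtype
    split_ifs with hg
    · have g3 := hg.2.2.1
      have g4 := hg.2.2.2
      rw [← hC] at g4
      have := comb (F A) (F' A)
        (lemC' _ _ (by omega) (RR_ne L' A b hb') _ (by rw [RR_fst]; exact hF A hbA hg))
        (lemC' _ _ (by omega) (RR_ne L C b hb) _ (by rw [RR_fst]; exact hF' A hbA hg))
      simpa using this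
    · by_cases c1 : Module.finrank ℂ (KK L A) + Module.finrank ℂ (L'.map (res A)) ≤ Fintype.card A
      · filter_upwards [ae_res b A hAb (blk_zero (KK L A) (RR L' A b) (by rw [RR_fst]; exact c1))]
          with mu g1
        rw [cx mu, g1, zero_mul]; rfl
      · by_cases c2 : Module.finrank ℂ (KK L' C) + Module.finrank ℂ (L.map (res C)) ≤ Fintype.card C
        · filter_upwards [ae_res b C hCb (blk_zero (KK L' C) (RR L C b) (by rw [RR_fst]; exact c2))]
            with mu g1
          rw [cx mu]
          change _ * Nat.card (BlkA (KK L' C) (RR L C b) (fun e => mu ⟨e, hCb e⟩)) = _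
          rw [g1, mul_zero]; rfl
        · exfalso
          apply hg
          refine ⟨hAn, hCn, by omega, ?_⟩
          rw [← hC]; omega
  have h3 := count_ae L L' b hdim P hP0 N hP
  have h4 := ae_all_iff.2 key
  obtain ⟨mu, m1, m2⟩ := (h3.and h4).exists
  rw [← m1, Finset.sum_congr rfl (fun A _ => m2 A), Finset.sum_add_distrib, Finset.sum_add_distrib]
  congr 2
  · rw [Finset.sum_eq_single ⟨{b}ᶜ, by simp⟩]
    · simp
    · intro A _ h; rw [if_neg]; intro h'; exact h (Subtype.ext h')
    · simp
  · rw [Finset.sum_eq_single ⟨∅, by simp⟩]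
    · simp
    · intro A _ h; rw [if_neg]; intro h'; exact h (Subtype.ext h')
    · simp



/-- coboundary map -/
def pot {U X : Type} (f s : X → U) : (U → ℂ) →ₗ[ℂ] (X → ℂ) :=
  LinearMap.funLeft ℂ ℂ s - LinearMap.funLeft ℂ ℂ f

theorem pot_apply {U X : Type} (f s : X → U) (p : U → ℂ) (e : X) :
    pot f s p e = p (s e) - p (f e) := rfl

def LL {U X : Type} (f s : X → U) : Submodule ℂ (X → ℂ) := LinearMap.range (pot f s)

theorem mem_LL {U X : Type} {f s : X → U} {a : X → ℂ} :
    a ∈ LL f s ↔ ∃ p : U → ℂ, ∀ e, a e = p (s e) - p (f e) := by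
  constructor
  · rintro ⟨p, rfl⟩; exact ⟨p, fun e => rfl⟩
  · rintro ⟨p, hp⟩; exact ⟨p, funext fun e => (hp e).symm⟩

theorem finrank_LL {U X : Type} [Finite U] [Finite X] (ends : X → Sym2 U) (f s : X → U)
    (hfs : ∀ e, ends e = s(f e, s e)) : Module.finrank ℂ (LL f s) = gDim ends := by
  have := Fintype.ofFinite U
  have := Fintype.ofFinite X
  have h1 := LinearMap.finrank_range_add_finrank_ker (pot f s)
  let q : (Quotient (ccSetoid ends) → ℂ) →ₗ[ℂ] (U → ℂ) :=
    LinearMap.funLeft ℂ ℂ (Quotient.mk (ccSetoid ends))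
  have hq : Function.Injective q :=
    LinearMap.funLeft_injective_of_surjective _ _ _ Quotient.mk_surjective
  have hr : LinearMap.range q = LinearMap.ker (pot f s) := by
    ext p
    rw [LinearMap.mem_ker]
    constructor
    · rintro ⟨g, rfl⟩
      funext e
      rw [pot_apply]
      change g _ - g _ = 0
      rw [sub_eq_zero]
      congr 1
      apply Quotient.sound
      exact Relation.EqvGen.symm _ _ (Relation.EqvGen.rel _ _ ⟨e, hfs e⟩)
    · intro hp
      have hp' : ∀ e, p (s e) = p (f e) := fun e => sub_eq_zero.1 (congrFun hp e)
      have hc : ∀ u v, (ccSetoid ends).r u v → p u = p v := by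
        intro u v h
        induction h with
        | rel u v h =>
          obtain ⟨e, he⟩ := h
          rw [hfs, Sym2.eq_iff] at he
          rcases he with ⟨rfl, rfl⟩ | ⟨rfl, rfl⟩
          · exact (hp' e).symm
          · exact hp' e
        | refl => rfl
        | symm _ _ _ ih => exact ih.symm
        | trans _ _ _ _ _ ih1 ih2 => exact ih1.trans ih2
      exact ⟨fun z => Quotient.lift p hc z, funext fun u => rfl⟩
  have := Fintype.ofFinite (Quotient (ccSetoid ends))
  have h2 : Module.finrank ℂ (LinearMap.ker (pot f s)) = numCC ends := by
    rw [← hr, LinearMap.finrank_range_of_inj hq, Module.finrank_fintype_fun_eq_card, numCC,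
      Nat.card_eq_fintype_card]
  rw [Module.finrank_fintype_fun_eq_card, h2] at h1
  rw [gDim, Nat.card_eq_fintype_card, ← h1]
  change _ = Module.finrank ℂ (LL f s) + _ - _
  omega

theorem LL_orient {U X : Type} (f s f' s' : X → U) (h : ∀ e, s(f' e, s' e) = s(f e, s e)) :
    ∃ t : X → ℂ, (∀ e, t e ≠ 0) ∧ ∀ a, a ∈ LL f s ↔ t * a ∈ LL f' s' := by
  refine ⟨fun e => if f' e = f e then 1 else -1, fun e => ?_, fun a => ?_⟩
  · dsimp only; split_ifs <;> norm_num
  · rw [mem_LL, mem_LL]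
    apply exists_congr; intro p
    apply forall_congr'; intro e
    have he := h e
    rw [Sym2.eq_iff] at he
    rw [Pi.mul_apply]
    split_ifs with h1
    · have : s' e = s e := by
        rcases he with he | he
        · exact he.2
        · rw [he.2, ← h1, he.1]
      rw [this, h1, one_mul]
    · rcases he with he | he
      · exact absurd he.1 h1
      · rw [he.1, he.2]
        constructor <;> intro hh
        · rw [hh]; ring
        · linear_combination -hh

theorem LL_diag {U X : Type} (f s : X → U) (e : X) (h : f e = s e) (a : X → ℂ) (ha : a ∈ LL f s) :
    a e = 0 := by
  obtain ⟨p, hp⟩ := mem_LL.1 ha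
  rw [hp, h, sub_self]

theorem KK_LL {U X : Type} (ends : X → Sym2 U) (f s : X → U)
    (hfs : ∀ e, ends e = s(f e, s e)) (M : Set X) :
    KK (LL f s) Mᶜ = LL (fun e : (Mᶜ : Set X) => Quotient.mk (contrSetoid ends M) (f e))
      (fun e : (Mᶜ : Set X) => Quotient.mk (contrSetoid ends M) (s e)) := by
  ext a
  rw [mem_LL]
  change ext0 Mᶜ a ∈ LL f s ↔ _
  rw [mem_LL]
  constructor
  · rintro ⟨p, hp⟩
    have hp' : ∀ e ∈ M, p (s e) = p (f e) := fun e he => by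
      have := hp e
      rw [ext0_apply, dif_neg (by simpa using he)] at this
      exact (sub_eq_zero.1 this.symm)
    have hc : ∀ u v, (contrSetoid ends M).r u v → p u = p v := by
      intro u v h
      induction h with
      | rel u v h =>
        obtain ⟨e, heM, he⟩ := h
        rw [hfs, Sym2.eq_iff] at he
        rcases he with ⟨rfl, rfl⟩ | ⟨rfl, rfl⟩
        · exact (hp' e heM).symm
        · exact hp' e heM
      | refl => rfl
      | symm _ _ _ ih => exact ih.symm
      | trans _ _ _ _ _ ih1 ih2 => exact ih1.trans ih2
    refine ⟨fun z => Quotient.lift p hc z, fun e => ?_⟩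
    have := hp e
    rw [ext0_apply, dif_pos e.2] at this
    exact this
  · rintro ⟨g, hg⟩
    refine ⟨fun u => g (Quotient.mk _ u), fun e => ?_⟩
    rw [ext0_apply]
    split_ifs with h
    · exact hg ⟨e, h⟩
    · have he : e ∈ M := by by_contra h'; exact h h'
      symm; rw [sub_eq_zero]
      refine congrArg g (Quotient.sound ?_)
      exact Relation.EqvGen.symm _ _ (Relation.EqvGen.rel _ _ ⟨e, he, hfs e⟩)

theorem res_LL {U X : Type} (f s : X → U) (S : Set X) :
    (LL f s).map (res S) = LL (fun e : S => f e) (fun e : S => s e) := by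
  rw [LL, ← LinearMap.range_comp]; rfl

theorem sMinMax {U : Type} [LinearOrder U] (z : Sym2 U) : z = s(sMin z, sMax z) := by
  induction z using Sym2.ind with
  | _ x y =>
    simp only [sMin, sMax, Sym2.lift_mk]
    rcases le_total x y with h | h
    · rw [min_eq_left h, max_eq_right h]
    · rw [min_eq_right h, max_eq_left h, Sym2.eq_swap]

/-! closed walks -/

def PS {U X : Type} (ends : X → Sym2 U) : Set (U × U) := {p | p.1 ≠ p.2 ∧ ∃ e, ends e = s(p.1, p.2)}

def CW {U : Type} {P : Set (U × U)} (x : P → ℂ) : Prop :=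
  ∀ (n : ℕ) (u : ℕ → U) (w : Fin n → P),
      (∀ i : Fin n, (w i : U × U) = (u i.1, u (i.1 + 1))) → u n = u 0 → ∑ i, x (w i) = 0

inductive Wk {U : Type} {P : Set (U × U)} (x : P → ℂ) : U → U → ℂ → Prop
  | nil (u) : Wk x u u 0
  | cons (q : P) (v : U) (c : ℂ) : Wk x q.1.2 v c → Wk x q.1.1 v (x q + c)

theorem Wk.append {U : Type} {P : Set (U × U)} {x : P → ℂ} {u v w : U} {c d : ℂ}
    (h : Wk x u v c) (h' : Wk x v w d) : Wk x u w (c + d) := by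
  induction h with
  | nil u => simpa using h'
  | cons q v c h ih => rw [add_assoc]; exact Wk.cons q w _ (ih h')

theorem Wk.single {U : Type} {P : Set (U × U)} {x : P → ℂ} (q : P) : Wk x q.1.1 q.1.2 (x q) := by
  simpa using Wk.cons (x := x) q q.1.2 0 (Wk.nil _)

theorem Wk.rev {U : Type} {P : Set (U × U)} (hP : ∀ p ∈ P, (p.2, p.1) ∈ P) {x : P → ℂ} {u v : U}
    {c : ℂ} (h : Wk x u v c) : ∃ d, Wk x v u d := by
  induction h with
  | nil u => exact ⟨0, Wk.nil u⟩
  | cons q v c h ih =>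
    obtain ⟨d, hd⟩ := ih
    exact ⟨_, hd.append (Wk.single (x := x) ⟨(q.1.2, q.1.1), hP _ q.2⟩)⟩

theorem Wk.walk {U : Type} {P : Set (U × U)} {x : P → ℂ} {u v : U} {c : ℂ} (h : Wk x u v c) :
    ∃ (n : ℕ) (us : ℕ → U) (w : Fin n → P),
      (∀ i : Fin n, (w i : U × U) = (us i.1, us (i.1 + 1))) ∧ us 0 = u ∧ us n = v ∧
      ∑ i, x (w i) = c := by
  induction h with
  | nil u => exact ⟨0, fun _ => u, fun i => i.elim0, fun i => i.elim0, rfl, rfl, by simp⟩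
  | cons q v c h ih =>
    obtain ⟨n, us, w, h1, h2, h3, h4⟩ := ih
    refine ⟨n + 1, fun k => Nat.casesOn k q.1.1 us, Fin.cons q w, ?_, rfl, h3, ?_⟩
    · intro i
      refine Fin.cases ?_ (fun i => ?_) i
      · simp [h2]
      · simpa using h1 i
    · rw [Fin.sum_univ_succ]; simp [h4]

theorem CW_pot {U : Type} {P : Set (U × U)} (hP : ∀ p ∈ P, (p.2, p.1) ∈ P) (x : P → ℂ) :
    CW x ↔ ∃ p : U → ℂ, ∀ q : P, x q = p q.1.2 - p q.1.1 := by
  constructor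
  · intro hx
    have hz : ∀ u c, Wk x u u c → c = 0 := by
      intro u c h
      obtain ⟨n, us, w, h1, h2, h3, h4⟩ := h.walk
      rw [← h4]; exact hx n us w h1 (by rw [h2, h3])
    have hu : ∀ u v c d, Wk x u v c → Wk x u v d → c = d := by
      intro u v c d h1 h2
      obtain ⟨c', h3⟩ := h1.rev hP
      have e1 := hz _ _ (h1.append h3)
      have e2 := hz _ _ (h2.append h3)
      linear_combination e1 - e2
    let st : Setoid U := ⟨fun u v => ∃ c, Wk x u v c, fun u => ⟨0, Wk.nil u⟩,
      fun ⟨c, h⟩ => h.rev hP, fun ⟨c, h⟩ ⟨d, h'⟩ => ⟨_, h.append h'⟩⟩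
    let r : U → U := fun u => (Quotient.mk st u).out
    have hr : ∀ u, ∃ c, Wk x (r u) u c := fun u => Quotient.exact (Quotient.out_eq (Quotient.mk st u))
    choose p hp using hr
    refine ⟨p, fun q => ?_⟩
    have hrr : r q.1.1 = r q.1.2 := by
      have : Quotient.mk st q.1.1 = Quotient.mk st q.1.2 := Quotient.sound ⟨_, Wk.single q⟩
      change Quotient.out _ = Quotient.out _
      rw [this]
    have h1 := (hp q.1.1).append (Wk.single (x := x) q)
    rw [hrr] at h1
    have := hu _ _ _ _ h1 (hp q.1.2)
    linear_combination this
  · rintro ⟨p, hp⟩ n u w hw hc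
    have : ∀ i : Fin n, x (w i) = (fun k : ℕ => p (u (k + 1)) - p (u k)) i := by
      intro i; rw [hp, hw]
    rw [Finset.sum_congr rfl (fun i _ => this i), Fin.sum_univ_eq_sum_range
      (fun k : ℕ => p (u (k + 1)) - p (u k)) n, Finset.sum_range_sub (fun k => p (u k)), hc, sub_self]



theorem PS_symm {U X : Type} (ends : X → Sym2 U) : ∀ p ∈ PS ends, (p.2, p.1) ∈ PS ends := by
  rintro p ⟨h1, e, he⟩
  exact ⟨h1.symm, e, by rw [he, Sym2.eq_swap]⟩

/-- restriction of edge functions from ordered pairs to edges -/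
def Phi {U X : Type} {ends : X → Sym2 U} {f s : X → U} (h : ∀ e, (f e, s e) ∈ PS ends)
    (x : PS ends → ℂ) : X → ℂ := fun e => x ⟨_, h e⟩

theorem Phi_mem {U X : Type} {ends : X → Sym2 U} {f s : X → U} (h : ∀ e, (f e, s e) ∈ PS ends)
    {x : PS ends → ℂ} (hx : CW x) : Phi h x ∈ LL f s := by
  obtain ⟨p, hp⟩ := (CW_pot (PS_symm ends) x).1 hx
  exact mem_LL.2 ⟨p, fun e => hp _⟩

theorem Phi_inj {U X : Type} {ends : X → Sym2 U} {f s : X → U} (h : ∀ e, (f e, s e) ∈ PS ends)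
    (hfs : ∀ e, ends e = s(f e, s e))
    {x y : PS ends → ℂ} (hx : CW x) (hy : CW y) (hxy : Phi h x = Phi h y) : x = y := by
  obtain ⟨p, hp⟩ := (CW_pot (PS_symm ends) x).1 hx
  obtain ⟨p', hp'⟩ := (CW_pot (PS_symm ends) y).1 hy
  funext q
  obtain ⟨⟨u, v⟩, hq1, e, he⟩ := q
  have h1 : x ⟨_, h e⟩ = y ⟨_, h e⟩ := congrFun hxy e
  rw [hp, hp'] at h1
  rw [hp, hp']
  rw [hfs, Sym2.eq_iff] at he
  rcases he with ⟨h2, h3⟩ | ⟨h2, h3⟩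
  · dsimp only at *
    rw [← h2, ← h3]; exact h1
  · dsimp only at *
    rw [← h2, ← h3]; linear_combination -h1

theorem Phi_surj {U X : Type} {ends : X → Sym2 U} {f s : X → U} (h : ∀ e, (f e, s e) ∈ PS ends)
    {a : X → ℂ} (ha : a ∈ LL f s) : ∃ x : PS ends → ℂ, CW x ∧ Phi h x = a := by
  obtain ⟨p, hp⟩ := mem_LL.1 ha
  refine ⟨fun q => p q.1.2 - p q.1.1, (CW_pot (PS_symm ends) _).2 ⟨p, fun q => rfl⟩, ?_⟩
  funext e; exact (hp e).symm

theorem hfsG (B : Bigraph) (e : B.ℰ) : B.τG e = s(B.eFstG e, B.eSndG e) := by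
  let _ := B.ordV
  exact sMinMax _

theorem hfsH (B : Bigraph) (e : B.ℰ) : B.τH e = s(B.eFstH e, B.eSndH e) := by
  let _ := B.ordW
  exact sMinMax _

theorem neG (B : Bigraph) (h : ¬ B.HasLoop) (e : B.ℰ) : B.eFstG e ≠ B.eSndG e := by
  intro h'
  apply h
  refine Or.inl ⟨e, ?_⟩
  rw [hfsG, h']; simp

theorem neH (B : Bigraph) (h : ¬ B.HasLoop) (e : B.ℰ) : B.eFstH e ≠ B.eSndH e := by
  intro h'
  apply h
  refine Or.inr ⟨e, ?_⟩
  rw [hfsH, h']; simp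

abbrev LGm (B : Bigraph) : Submodule ℂ (B.ℰ → ℂ) := LL B.eFstG B.eSndG
abbrev LHm (B : Bigraph) : Submodule ℂ (B.ℰ → ℂ) := LL B.eFstH B.eSndH

theorem ZSet_equiv (B : Bigraph) (h : ¬ B.HasLoop) (b : B.ℰ) (lam : {e : B.ℰ // e ≠ b} → ℂ) :
    Nonempty (B.ZSet b lam ≃ Zl (LGm B) (LHm B) b lam) := by
  have hG : ∀ e, (B.eFstG e, B.eSndG e) ∈ PS B.τG := fun e => ⟨neG B h e, e, hfsG B e⟩
  have hH : ∀ e, (B.eFstH e, B.eSndH e) ∈ PS B.τH := fun e => ⟨neH B h e, e, hfsH B e⟩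
  refine ⟨Equiv.ofBijective (fun z => ⟨(Phi hG z.1.1, Phi hH z.1.2), ?_⟩) ⟨?_, ?_⟩⟩
  · obtain ⟨h1, h2, h3, h4, h5⟩ := z.2
    exact ⟨Phi_mem hG h4, Phi_mem hH h5, h1 ⟨_, hG b⟩ rfl, h2 ⟨_, hH b⟩ rfl,
      fun e => h3 e ⟨_, hG e⟩ ⟨_, hH e⟩ rfl rfl⟩
  · rintro ⟨⟨x, y⟩, hz⟩ ⟨⟨x', y'⟩, hz'⟩ hh
    have e1 : Phi hG x = Phi hG x' := congrArg (fun q => q.1.1) hh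
    have e2 : Phi hH y = Phi hH y' := congrArg (fun q => q.1.2) hh
    have e3 : x = x' := Phi_inj hG (hfsG B) hz.2.2.2.1 hz'.2.2.2.1 e1
    have e4 : y = y' := Phi_inj hH (hfsH B) hz.2.2.2.2 hz'.2.2.2.2 e2
    subst e3 e4; rfl
  · rintro ⟨⟨a, c⟩, ha, hc, h1, h2, h3⟩
    obtain ⟨x, hx, hxa⟩ := Phi_surj hG ha
    obtain ⟨y, hy, hyc⟩ := Phi_surj hH hc
    dsimp only at hxa hyc h1 h2 h3
    subst hxa hyc
    refine ⟨⟨(x, y), ?_, ?_, ?_, hx, hy⟩, rfl⟩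
    · intro p hp
      rw [← h1]
      exact congrArg x (Subtype.ext hp)
    · intro p hp
      rw [← h2]
      exact congrArg y (Subtype.ext hp)
    · intro e p q hp hq
      rw [← h3 e]
      exact congrArg₂ (· * ·) (congrArg x (Subtype.ext hp)) (congrArg y (Subtype.ext hq))

theorem Zl_swap {X : Type} (L L' : Submodule ℂ (X → ℂ)) (b : X) (lam : {e : X // e ≠ b} → ℂ) :
    Nat.card (Zl L L' b lam) = Nat.card (Zl L' L b lam) := by
  refine Nat.card_congr ⟨fun z => ⟨z.1.swap, ?_⟩, fun z => ⟨z.1.swap, ?_⟩, fun _ => rfl, fun _ => rfl⟩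
  · obtain ⟨h1, h2, h3, h4, h5⟩ := z.2
    exact ⟨h2, h1, h4, h3, fun e => by rw [mul_comm]; exact h5 e⟩
  · obtain ⟨h1, h2, h3, h4, h5⟩ := z.2
    exact ⟨h2, h1, h4, h3, fun e => by rw [mul_comm]; exact h5 e⟩

/-- data of a Laman number in linear terms -/
theorem laman_linear (B : Bigraph) (b : B.ℰ) (N : ℕ) (h : B.HasLamanNumber b N) :
    (N = 0 ∧ ((∃ e, ∀ a ∈ LGm B, a e = 0) ∨ (∃ e, ∀ c ∈ LHm B, c e = 0))) ∨
    ∃ P : MvPolynomial {e : B.ℰ // e ≠ b} ℂ, P ≠ 0 ∧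
      ∀ lam, MvPolynomial.eval lam P ≠ 0 →
        (Zl (LGm B) (LHm B) b lam).Finite ∧ Nat.card (Zl (LGm B) (LHm B) b lam) = N := by
  rcases h with ⟨h, rfl⟩ | ⟨h, P, hP0, hP⟩
  · left
    refine ⟨rfl, ?_⟩
    rcases h with ⟨e, he⟩ | ⟨e, he⟩
    · rw [hfsG, Sym2.mk_isDiag_iff] at he
      exact Or.inl ⟨e, fun a ha => LL_diag _ _ e he a ha⟩
    · rw [hfsH, Sym2.mk_isDiag_iff] at he
      exact Or.inr ⟨e, fun a ha => LL_diag _ _ e he a ha⟩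
  · right
    refine ⟨P, hP0, fun lam hl => ?_⟩
    obtain ⟨φ⟩ := ZSet_equiv B h b lam
    obtain ⟨h1, h2⟩ := hP lam hl
    have : Finite (B.ZSet b lam) := h1
    exact ⟨Finite.of_equiv _ φ, by rw [← h2]; exact (Nat.card_congr φ).symm⟩

theorem BH_ctrG (B : Bigraph) (M : Set B.ℰ) (o) (e' : (B.ctrG M o).ℰ) (N : ℕ)
    (h : (B.ctrG M o).HasLamanNumber e' N) :
    BH (KK (LGm B) Mᶜ) ((LHm B).map (res Mᶜ)) N := by
  obtain ⟨t, ht0, ht⟩ := LL_orient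
    (fun e : (Mᶜ : Set B.ℰ) => Quotient.mk (contrSetoid B.τG M) (B.eFstG e))
    (fun e : (Mᶜ : Set B.ℰ) => Quotient.mk (contrSetoid B.τG M) (B.eSndG e))
    (B.ctrG M o).eFstG (B.ctrG M o).eSndG (fun e => (hfsG (B.ctrG M o) e).symm.trans
      (congrArg (Sym2.map (Quotient.mk (contrSetoid B.τG M))) (hfsG B e.1)))
  rw [KK_LL B.τG _ _ (hfsG B), res_LL]
  rcases laman_linear _ _ _ h with ⟨hN, hh⟩ | ⟨P, hP0, hP⟩
  · left
    refine ⟨hN, ?_⟩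
    rcases hh with ⟨e, he⟩ | ⟨e, he⟩
    · left
      refine ⟨e, fun a ha => ?_⟩
      have := he _ ((ht a).1 ha)
      exact (mul_eq_zero.1 this).resolve_left (ht0 e)
    · exact Or.inr ⟨e, he⟩
  · right
    exact ⟨_, t, e', P, ht0, ht, hP0, fun lam hl => (hP lam hl).2⟩

theorem BH_ctrH (B : Bigraph) (M : Set B.ℰ) (o) (e' : (B.ctrH M o).ℰ) (N : ℕ)
    (h : (B.ctrH M o).HasLamanNumber e' N) :
    BH (KK (LHm B) Mᶜ) ((LGm B).map (res Mᶜ)) N := by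
  obtain ⟨t, ht0, ht⟩ := LL_orient
    (fun e : (Mᶜ : Set B.ℰ) => Quotient.mk (contrSetoid B.τH M) (B.eFstH e))
    (fun e : (Mᶜ : Set B.ℰ) => Quotient.mk (contrSetoid B.τH M) (B.eSndH e))
    (B.ctrH M o).eFstH (B.ctrH M o).eSndH (fun e => (hfsH (B.ctrH M o) e).symm.trans
      (congrArg (Sym2.map (Quotient.mk (contrSetoid B.τH M))) (hfsH B e.1)))
  rw [KK_LL B.τH _ _ (hfsH B), res_LL]
  rcases laman_linear _ _ _ h with ⟨hN, hh⟩ | ⟨P, hP0, hP⟩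
  · left
    refine ⟨hN, ?_⟩
    rcases hh with ⟨e, he⟩ | ⟨e, he⟩
    · exact Or.inr ⟨e, he⟩
    · left
      refine ⟨e, fun a ha => ?_⟩
      have := he _ ((ht a).1 ha)
      exact (mul_eq_zero.1 this).resolve_left (ht0 e)
  · right
    refine ⟨_, t, e', P, ht0, ht, hP0, fun lam hl => ?_⟩
    exact (Zl_swap _ _ _ _).trans (hP lam hl).2

theorem PL_ctrG (B : Bigraph) (M : Set B.ℰ) (o) : (B.ctrG M o).PseudoLaman ↔
    Module.finrank ℂ (KK (LGm B) Mᶜ) + Module.finrank ℂ ((LHm B).map (res Mᶜ)) =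
      Nat.card (Mᶜ : Set B.ℰ) + 1 := by
  rw [KK_LL B.τG _ _ (hfsG B), res_LL,
    finrank_LL (X := (Mᶜ : Set B.ℰ)) (contractEnds B.τG M) _ _ (fun e =>
      congrArg (Sym2.map (Quotient.mk (contrSetoid B.τG M))) (hfsG B e.1)),
    finrank_LL (X := (Mᶜ : Set B.ℰ)) (deleteEnds B.τH M) _ _ (fun e => hfsH B e.1)]
  rfl

theorem PL_ctrH (B : Bigraph) (M : Set B.ℰ) (o) : (B.ctrH M o).PseudoLaman ↔
    Module.finrank ℂ (KK (LHm B) Mᶜ) + Module.finrank ℂ ((LGm B).map (res Mᶜ)) =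
      Nat.card (Mᶜ : Set B.ℰ) + 1 := by
  rw [KK_LL B.τH _ _ (hfsH B), res_LL,
    finrank_LL (X := (Mᶜ : Set B.ℰ)) (contractEnds B.τH M) _ _ (fun e =>
      congrArg (Sym2.map (Quotient.mk (contrSetoid B.τH M))) (hfsH B e.1)),
    finrank_LL (X := (Mᶜ : Set B.ℰ)) (deleteEnds B.τG M) _ _ (fun e => hfsG B e.1), add_comm]
  rfl

theorem LL_ne {U X : Type} (f s : X → U) (b : X) (h : f b ≠ s b) : ∃ x ∈ LL f s, x b ≠ 0 := by
  refine ⟨_, ⟨fun u => if u = s b then 1 else 0, rfl⟩, ?_⟩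
  rw [pot_apply, if_pos rfl, if_neg h]; norm_num



theorem exists_linearOrder (U : Type) : Nonempty (LinearOrder U) :=
  ⟨linearOrderOfSTO WellOrderingRel⟩

theorem goodPair_iff (B : Bigraph) [Fintype B.ℰ] (b : B.ℰ) (A : Set B.ℰ) (hb : b ∉ A) :
    GoodPair B b (Aᶜ, insert b A) ↔ GoodA (LGm B) (LHm B) b A := by
  have hAc : Aᶜ = insert b (insert b A)ᶜ := by
    ext e
    by_cases h : e = b
    · subst h; simp [hb]
    · simp [h]
  have hcc : ∀ S : Set B.ℰ, b ∉ S → (2 ≤ (insert b S).ncard ↔ S.Nonempty) := by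
    intro S hS
    rw [Set.ncard_insert_of_notMem hS, ← Set.ncard_pos]
    omega
  have c1 : 2 ≤ (Aᶜ).ncard ↔ ((insert b A)ᶜ : Set B.ℰ).Nonempty := by
    rw [hAc]; exact hcc _ (by simp)
  have c2 := hcc A hb
  have u1 : Aᶜ ∪ insert b A = Set.univ := by
    ext e; by_cases h : e ∈ A <;> simp [h]
  have u2 : Aᶜ ∩ insert b A = {b} := by
    ext e; by_cases h : e = b
    · subst h; simp [hb]
    · simp [h]
  have p1 : (∀ o, (B.ctrG Aᶜ o).PseudoLaman) ↔
      Module.finrank ℂ (KK (LGm B) A) + Module.finrank ℂ ((LHm B).map (res A)) =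
        Nat.card A + 1 := by
    obtain ⟨o⟩ := exists_linearOrder (Quotient (contrSetoid B.τG Aᶜ))
    have : Nonempty (LinearOrder (Quotient (contrSetoid B.τG Aᶜ))) := ⟨o⟩
    simp only [PL_ctrG, forall_const]
    rw [compl_compl]
  have p2 : (∀ o, (B.ctrH (insert b A) o).PseudoLaman) ↔
      Module.finrank ℂ (KK (LHm B) (insert b A)ᶜ) +
        Module.finrank ℂ ((LGm B).map (res (insert b A)ᶜ)) =
        Nat.card ((insert b A)ᶜ : Set B.ℰ) + 1 := by
    have := exists_linearOrder (Quotient (contrSetoid B.τH (insert b A)))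
    simp only [PL_ctrH, forall_const]
  unfold GoodPair GoodA
  dsimp only
  rw [p1, p2, c1, c2]
  constructor
  · rintro ⟨-, -, h3, h4, h5, h6⟩; exact ⟨h4, h3, h5, h6⟩
  · rintro ⟨h4, h3, h5, h6⟩; exact ⟨u1, u2, h3, h4, h5, h6⟩

theorem statement0 (B : Bigraph) (hE : 2 ≤ Nat.card B.ℰ) (hloop : ¬ B.HasLoop)
    (hpl : B.PseudoLaman) (ebar : B.ℰ) (N N₁ N₂ : ℕ)
    (F F' : Set B.ℰ × Set B.ℰ → ℕ)
    (hB : B.HasLamanNumber ebar N)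
    (h1 : ∃ (o : LinearOrder (Quotient (contrSetoid B.τG ({ebar} : Set B.ℰ))))
            (e' : (B.ctrG {ebar} o).ℰ), (B.ctrG {ebar} o).HasLamanNumber e' N₁)
    (h2 : ∃ (o : LinearOrder (Quotient (contrSetoid B.τH ({ebar} : Set B.ℰ))))
            (e' : (B.ctrH {ebar} o).ℰ), (B.ctrH {ebar} o).HasLamanNumber e' N₂)
    (hF : ∀ MN : Set B.ℰ × Set B.ℰ, GoodPair B ebar MN →
            ∃ (o : LinearOrder (Quotient (contrSetoid B.τG MN.1)))
              (e' : (B.ctrG MN.1 o).ℰ), (B.ctrG MN.1 o).HasLamanNumber e' (F MN))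
    (hF' : ∀ MN : Set B.ℰ × Set B.ℰ, GoodPair B ebar MN →
            ∃ (o : LinearOrder (Quotient (contrSetoid B.τH MN.2)))
              (e' : (B.ctrH MN.2 o).ℰ), (B.ctrH MN.2 o).HasLamanNumber e' (F' MN)) :
    N = N₁ + N₂ + ∑ᶠ MN ∈ {MN : Set B.ℰ × Set B.ℰ | GoodPair B ebar MN}, F MN * F' MN := by
  have := Fintype.ofFinite B.ℰ
  have hxG := LL_ne B.eFstG B.eSndG ebar (neG B hloop ebar)
  have hxH := LL_ne B.eFstH B.eSndH ebar (neH B hloop ebar)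
  have hP : ∃ P : MvPolynomial {e : B.ℰ // e ≠ ebar} ℂ, P ≠ 0 ∧
      ∀ lam, MvPolynomial.eval lam P ≠ 0 →
        (Zl (LGm B) (LHm B) ebar lam).Finite ∧ Nat.card (Zl (LGm B) (LHm B) ebar lam) = N := by
    rcases hB with hB | ⟨h, P, hP0, hP⟩
    · exact absurd hB.1 hloop
    · refine ⟨P, hP0, fun lam hl => ?_⟩
      obtain ⟨φ⟩ := ZSet_equiv B h ebar lam
      obtain ⟨g1, g2⟩ := hP lam hl
      have : Finite (B.ZSet ebar lam) := g1
      exact ⟨Finite.of_equiv _ φ, by rw [← g2]; exact (Nat.card_congr φ).symm⟩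
  obtain ⟨P, hP0, hP⟩ := hP
  obtain ⟨o1, e1, h1⟩ := h1
  obtain ⟨o2, e2, h2⟩ := h2
  have hdim : Module.finrank ℂ (LGm B) + Module.finrank ℂ (LHm B) = Fintype.card B.ℰ + 1 := by
    rw [finrank_LL B.τG _ _ (hfsG B), finrank_LL B.τH _ _ (hfsH B), ← Nat.card_eq_fintype_card]
    exact hpl
  have key := main_linear (LGm B) (LHm B) ebar hdim hxG hxH
    (by rw [← Nat.card_eq_fintype_card]; exact hE) P hP0 N N₁ N₂ hP
    (BH_ctrG B _ o1 e1 _ h1) (BH_ctrH B _ o2 e2 _ h2)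
    (fun A => F (Aᶜ, insert ebar A)) (fun A => F' (Aᶜ, insert ebar A))
    (fun A hA hg => by
      obtain ⟨o, e', h⟩ := hF _ ((goodPair_iff B ebar A hA).2 hg)
      have := BH_ctrG B _ o e' _ h
      dsimp only at this
      rwa [compl_compl] at this)
    (fun A hA hg => by
      obtain ⟨o, e', h⟩ := hF' _ ((goodPair_iff B ebar A hA).2 hg)
      exact BH_ctrH B _ o e' _ h)
  rw [key]
  congr 1
  have hbij : Set.BijOn (fun A : {A : Set B.ℰ // ebar ∉ A} => (A.1ᶜ, insert ebar A.1))
      {A | GoodA (LGm B) (LHm B) ebar A.1}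
      {MN : Set B.ℰ × Set B.ℰ | GoodPair B ebar MN} := by
    refine ⟨fun A hA => (goodPair_iff B ebar A.1 A.2).2 hA, ?_, ?_⟩
    · intro A _ A' _ h
      exact Subtype.ext (compl_injective (congrArg Prod.fst h))
    · rintro ⟨M, K⟩ h
      have h : GoodPair B ebar (M, K) := h
      obtain ⟨u1, u2, -⟩ := h
      dsimp only at u1 u2
      have hm : ∀ e, e ∈ M ∧ e ∈ K ↔ e = ebar := fun e => by
        have : e ∈ M ∩ K ↔ e ∈ ({ebar} : Set B.ℰ) := by rw [u2]
        simpa using this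
      have hu : ∀ e, e ∈ M ∨ e ∈ K := fun e => by
        have : e ∈ M ∪ K := by rw [u1]; trivial
        simpa using this
      have hb : ebar ∉ Mᶜ := by
        have := ((hm ebar).2 rfl).1
        simpa using this
      have hK : insert ebar Mᶜ = K := by
        ext e
        have g1 := hm e
        have g2 := hu e
        simp only [Set.mem_insert_iff, Set.mem_compl_iff]
        tauto
      have hp : (Mᶜᶜ, insert ebar Mᶜ) = (M, K) := by rw [hK, compl_compl]
      refine ⟨⟨Mᶜ, hb⟩, ?_, hp⟩
      apply (goodPair_iff B ebar Mᶜ hb).1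
      rw [hp]; exact h
  rw [← finsum_mem_eq_of_bijOn _ hbij (fun A _ => rfl), finsum_mem_def, finsum_eq_sum_of_fintype]
  refine Finset.sum_congr rfl fun A _ => ?_
  rw [Set.indicator_apply]
  rfl

end LamanPaper
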